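/- arXiv:2311.03230 — 8 statements merged into one kernel-verified Lean document; each statement's English description precedes it below -/
import Mathlib

section
/- Let E be a ground set of n elements and let S_1,…,S_m ⊆ E be subsets with S_1 ∪ … ∪ S_m = E. There exists a permutation π of {1,…,m} such that for every permutation π' of {1,…,m} and every k ∈ {1,…,n}, the k-th smallest cover time under π is at most 4 times the k-th smallest cover time under π'. -/
/-- The vector of absolute values of the coordinates of `x`, sorted in decreasing order. -/
noncomputable def absSortDesc {d : ℕ} (x : Fin d → ℝ) : Fin d → ℝ :=
  fun k => |x (Tuple.sort (fun i => |x i|) k.rev)|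

/-- The ordered norm `‖x‖_(w) = Σ_k w_k (|x|↓)_k`. -/
noncomputable def orderedNorm {d : ℕ} (w x : Fin d → ℝ) : ℝ :=
  ∑ k, w k * absSortDesc x k

/-- The top-`k` norm: the sum of the `k` largest coordinates of `|x|`. -/
noncomputable def topkNorm {d : ℕ} (k : ℕ) (x : Fin d → ℝ) : ℝ :=
  ∑ i ∈ Finset.univ.filter (fun i : Fin d => (i : ℕ) < k), absSortDesc x i

/-- A weight vector: nonincreasing, nonnegative, nonzero. -/
def IsWeightVector {d : ℕ} (w : Fin d → ℝ) : Prop :=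
  Antitone w ∧ (∀ k, 0 ≤ w k) ∧ w ≠ 0

/-- A symmetric monotonic norm on `ι → ℝ`. -/
def IsSymMonotoneNorm {ι : Type*} [Fintype ι] (f : (ι → ℝ) → ℝ) : Prop :=
  (∀ x, f x = 0 ↔ x = 0) ∧
  (∀ (a : ℝ) (x : ι → ℝ), f (a • x) = |a| * f x) ∧
  (∀ x y : ι → ℝ, f (x + y) ≤ f x + f y) ∧
  (∀ (σ : Equiv.Perm ι) (x : ι → ℝ), f (x ∘ σ) = f x) ∧
  (∀ x y : ι → ℝ, (∀ i, 0 ≤ x i) → (∀ i, x i ≤ y i) → f x ≤ f y)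

/-- Feasible load vectors of the Machine-Loads-Identical-Jobs problem. -/
def MLIJ {d : ℕ} (p : Fin d → ℝ) (n : ℕ) : Set (Fin d → ℝ) :=
  { x | ∃ m : Fin d → ℕ, (∑ i, m i) = n ∧ ∀ i, x i = (m i : ℝ) * p i }

/-- The dual of the ordered norm. -/
noncomputable def dualOrderedNorm {d : ℕ} (w y : Fin d → ℝ) : ℝ :=
  sSup { r : ℝ | ∃ x : Fin d → ℝ, orderedNorm w x ≤ 1 ∧ r = ∑ i, y i * x i }

/-- The coordinates of `x` sorted in increasing order. -/
noncomputable def sortAsc {n : ℕ} (x : Fin n → ℝ) : Fin n → ℝ :=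
  fun k => x (Tuple.sort x k)

/-- Distance vector induced by a set of open facilities. -/
noncomputable def distVec {X : Type*} [MetricSpace X] (F : Finset X) : X → ℝ :=
  fun j => sInf ((fun c => dist j c) '' (F : Set X))

/-- `x(l)`: the vector with the first `l+1` coordinates (indices `≤ l`) equal to
`n / Σ_{j ≤ l} 1/p_j` and zero elsewhere. -/
noncomputable def vertexX {d : ℕ} (p : Fin d → ℝ) (n : ℝ) (l : Fin d) : Fin d → ℝ :=
  fun i => if i ≤ l then n / (∑ j ∈ Finset.univ.filter (fun j : Fin d => j ≤ l), 1 / p j) else 0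

/-- Completion time of job `j` when job `j'` is assigned to machine `a j'` and jobs are
processed on each machine in the order induced by the priority permutation `π`. -/
noncomputable def completionTime {n d : ℕ} (p : Fin d → Fin n → ℝ)
    (a : Fin n → Fin d) (π : Equiv.Perm (Fin n)) : Fin n → ℝ :=
  fun j => ∑ j' ∈ Finset.univ.filter (fun j' : Fin n => a j' = a j ∧ π j' ≤ π j), p (a j) j'

/-- A tour on `n` vertices starting at `v₀`: `τ 0 = v₀` and `τ` is a bijection from
`{0, …, n-1}` onto the vertex set. -/
def IsTour {V : Type*} (n : ℕ) (v₀ : V) (τ : ℕ → V) : Prop :=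
  τ 0 = v₀ ∧ Set.BijOn τ (Set.Iio n) Set.univ

/-- The visit times of the vertices `τ 0, …, τ (n-1)` of a tour. -/
noncomputable def tourVisitTimes {V : Type*} [MetricSpace V] (n : ℕ) (τ : ℕ → V) : Fin n → ℝ :=
  fun i => ∑ j ∈ Finset.range (i : ℕ), dist (τ j) (τ (j + 1))

/-- Cover time of element `e` under the ordering `π` of the subsets `S 0, …, S (m-1)`:
the position (in `{1, …, m}`) of the first subset containing `e`. -/
noncomputable def coverTime {n m : ℕ} (S : Fin m → Finset (Fin n))
    (π : Equiv.Perm (Fin m)) (e : Fin n) : ℕ :=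
  1 + sInf {t : ℕ | ∃ h : t < m, e ∈ S (π ⟨t, h⟩)}

/-- An entry of the sorted vector is at most `a` iff enough coordinates are at most `a`. -/
lemma sortAsc_le_iff {n : ℕ} (x : Fin n → ℝ) (k : Fin n) (a : ℝ) :
    sortAsc x k ≤ a ↔ (k : ℕ) < (Finset.univ.filter fun e => x e ≤ a).card := by
  have hcard : (Finset.univ.filter fun i => (x ∘ Tuple.sort x) i ≤ a).card =
      (Finset.univ.filter fun e => x e ≤ a).card :=
    Finset.card_equiv (Tuple.sort x) (by simp)
  rw [← hcard]
  exact (Tuple.lt_card_le_iff_apply_le_of_monotone (Tuple.monotone_sort x)).symm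

lemma coverTime_le_iff {n m : ℕ} (S : Fin m → Finset (Fin n))
    (hcover : ∀ e : Fin n, ∃ i : Fin m, e ∈ S i) (π : Equiv.Perm (Fin m)) (e : Fin n) (s : ℕ) :
    coverTime S π e ≤ s ↔ ∃ t : Fin m, (t : ℕ) < s ∧ e ∈ S (π t) := by
  have hne : {t : ℕ | ∃ h : t < m, e ∈ S (π ⟨t, h⟩)}.Nonempty := by
    obtain ⟨i, hi⟩ := hcover e
    exact ⟨π.symm i, (π.symm i).isLt, by simpa using hi⟩
  unfold coverTime
  constructor
  · intro h
    obtain ⟨ht, he⟩ := Nat.sInf_mem hne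
    exact ⟨⟨_, ht⟩, by simp only; omega, he⟩
  · rintro ⟨t, ht, he⟩
    have := Nat.sInf_le (s := {t : ℕ | ∃ h : t < m, e ∈ S (π ⟨t, h⟩)}) ⟨t.isLt, he⟩
    omega

/-- Among the families of at most `c` subsets there is one of maximum coverage, which may be
taken to be the full family when `c` allows it. -/
lemma exists_max_coverage {n m : ℕ} (S : Fin m → Finset (Fin n)) (c : ℕ) :
    ∃ A : Finset (Fin m), A.card ≤ c ∧ (m ≤ c → A = Finset.univ) ∧
      ∀ B : Finset (Fin m), B.card ≤ c → (B.biUnion S).card ≤ (A.biUnion S).card := by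
  by_cases hc : m ≤ c
  · exact ⟨Finset.univ, by simpa using hc, fun _ => rfl, fun B _ =>
      Finset.card_le_card (Finset.biUnion_subset_biUnion_of_subset_left S B.subset_univ)⟩
  · obtain ⟨A, hA, hmax⟩ := Finset.exists_max_image
      (Finset.univ.filter fun A : Finset (Fin m) => A.card ≤ c)
      (fun A => (A.biUnion S).card) ⟨∅, by simp⟩
    exact ⟨A, by simpa using hA, fun h => absurd h hc, fun B hB => hmax B (by simpa using hB)⟩

/-- Listing exhausting families `A 0, A 1, …` with `|A i| ≤ 2 ^ i` one after the other places
`A i` within the first `2 ^ (i + 1) - 1` positions. -/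
lemma exists_perm_of_card_le_two_pow {m : ℕ} (A : ℕ → Finset (Fin m))
    (hcard : ∀ i, (A i).card ≤ 2 ^ i) (hex : ∀ x, ∃ i, x ∈ A i) :
    ∃ π : Equiv.Perm (Fin m), ∀ i, ∀ x ∈ A i, (π.symm x : ℕ) < 2 ^ (i + 1) - 1 := by
  classical
  let rank : Fin m → ℕ := fun x => Nat.find (hex x)
  refine ⟨Tuple.sort rank, fun i x hx => ?_⟩
  set π := Tuple.sort rank
  have hsub : (Finset.Iic (π.symm x)).image π ⊆ (Finset.range (i + 1)).biUnion A := by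
    intro y hy
    obtain ⟨q, hq, rfl⟩ := Finset.mem_image.1 hy
    have hle : rank (π q) ≤ rank (π (π.symm x)) :=
      Tuple.monotone_sort rank (Finset.mem_Iic.1 hq)
    rw [Equiv.apply_symm_apply] at hle
    have hxi : rank x ≤ i := Nat.find_min' (hex x) hx
    exact Finset.mem_biUnion.2
      ⟨rank (π q), Finset.mem_range.2 (by omega), Nat.find_spec (hex (π q))⟩
  have h := Finset.card_le_card hsub
  rw [Finset.card_image_of_injective _ π.injective, Fin.card_Iic] at h
  have hsum : ((Finset.range (i + 1)).biUnion A).card ≤ 2 ^ (i + 1) - 1 :=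
    calc _ ≤ ∑ j ∈ Finset.range (i + 1), (A j).card := Finset.card_biUnion_le
      _ ≤ ∑ j ∈ Finset.range (i + 1), 2 ^ j := Finset.sum_le_sum fun j _ => hcard j
      _ = 2 ^ (i + 1) - 1 := by rw [Nat.geomSum_eq le_rfl]; simp
  omega

/-- Theorem: existence of a simultaneous 4-approximation for Ordered-Set-Cover. -/
theorem stmt7 (n m : ℕ) (S : Fin m → Finset (Fin n))
    (hcover : ∀ e : Fin n, ∃ i : Fin m, e ∈ S i) :
    ∃ π : Equiv.Perm (Fin m),
      ∀ π' : Equiv.Perm (Fin m), ∀ k : Fin n,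
        sortAsc (fun e => (coverTime S π e : ℝ)) k ≤
          4 * sortAsc (fun e => (coverTime S π' e : ℝ)) k := by
  choose A hAcard hAuniv hAmax using fun i : ℕ => exists_max_coverage S (2 ^ i)
  obtain ⟨π, hπ⟩ := exists_perm_of_card_le_two_pow A hAcard
    fun x => ⟨m, by rw [hAuniv m Nat.lt_two_pow_self.le]; exact Finset.mem_univ x⟩
  refine ⟨π, fun π' k => ?_⟩
  obtain ⟨T, hTpos, hT⟩ : ∃ T : ℕ, 1 ≤ T ∧ sortAsc (fun e => (coverTime S π' e : ℝ)) k = T :=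
    ⟨_, by unfold coverTime; omega, rfl⟩
  have hk := (sortAsc_le_iff _ k _).1 hT.le
  obtain ⟨i, hTi, hiT⟩ : ∃ i, T ≤ 2 ^ i ∧ 2 ^ (i + 1) - 1 ≤ 4 * T := by
    obtain rfl | hT1 := hTpos.eq_or_lt
    · exact ⟨0, by norm_num⟩
    · refine ⟨Nat.clog 2 T, Nat.le_pow_clog one_lt_two T, ?_⟩
      have hlt := Nat.pow_pred_clog_lt_self one_lt_two hT1
      have hpos := Nat.clog_pos one_lt_two hT1
      obtain ⟨j, hj⟩ := Nat.exists_eq_succ_of_ne_zero hpos.ne'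
      rw [hj] at hlt ⊢
      simp only [Nat.pred_eq_sub_one, Nat.succ_eq_add_one, Nat.add_sub_cancel, pow_succ] at hlt ⊢
      omega
  rw [hT, sortAsc_le_iff]
  let B : Finset (Fin m) := (Finset.univ.filter fun t : Fin m => (t : ℕ) < 2 ^ i).image π'
  have hB : B.card ≤ 2 ^ i :=
    Finset.card_image_le.trans (by rw [Fin.card_filter_val_lt]; exact min_le_right _ _)
  refine hk.trans_le (le_trans (Finset.card_le_card (t := B.biUnion S) ?_)
    ((hAmax i B hB).trans (Finset.card_le_card ?_)))
  · intro e he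
    have he' : coverTime S π' e ≤ T := by simpa using he
    obtain ⟨t, ht, hmem⟩ := (coverTime_le_iff S hcover π' e T).1 he'
    exact Finset.mem_biUnion.2
      ⟨π' t, Finset.mem_image_of_mem _ (by simpa using ht.trans_le hTi), hmem⟩
  · intro e he
    obtain ⟨x, hx, hmem⟩ := Finset.mem_biUnion.1 he
    have hcov : coverTime S π e ≤ 4 * T := (coverTime_le_iff S hcover π e _).2
      ⟨π.symm x, (hπ i x hx).trans_le hiT, by simpa using hmem⟩
    simpa using (by exact_mod_cast hcov : (coverTime S π e : ℝ) ≤ 4 * T)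
end

section
/- Let (X, dist) be a finite metric space with |X| = n ≥ 2, let k ∈ {1,…,n}, and let ε ∈ (0,1]. There exists a set C ⊆ X with |C| ≤ k·(1 + ⌈log_{1+ε}(n/ε)⌉) such that for every nonempty F ⊆ X with |F| ≤ k and every symmetric monotonic norm ‖·‖_f on ℝ^n, it holds that ‖x^C‖_f ≤ (1 + 2ε)·‖x^F‖_f. -/
/-- If all initial sums of `d` are nonnegative, then weighting `d` by an antitone family bounded
below by `c` gives at least `c` times the total sum. -/
theorem mul_sum_le_sum_mul_of_antitone {n : ℕ} {a d : Fin n → ℝ} (ha : Antitone a)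
    (hd : ∀ l ≤ n, 0 ≤ ∑ i : Fin n, if (i : ℕ) < l then d i else 0) {c : ℝ} (hc : ∀ i, c ≤ a i) :
    c * ∑ i, d i ≤ ∑ i, a i * d i := by
  induction n generalizing c with
  | zero => simp
  | succ n ih =>
    have hD : 0 ≤ ∑ i, d i := by
      have h := hd (n + 1) le_rfl
      simpa only [Fin.is_lt, if_true] using h
    have key := ih (a := fun i => a i.castSucc) (d := fun i => d i.castSucc)
      (fun i j hij => ha (by simpa using hij))
      (fun l hl => by
        have h := hd l (by omega)
        rw [Fin.sum_univ_castSucc] at h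
        simpa [Nat.not_lt.mpr hl] using h)
      (c := a (Fin.last n)) (fun i => ha (Fin.le_last _))
    calc c * ∑ i, d i ≤ a (Fin.last n) * ∑ i, d i :=
          mul_le_mul_of_nonneg_right (hc _) hD
      _ ≤ ∑ i, a i * d i := by
          rw [Fin.sum_univ_castSucc, Fin.sum_univ_castSucc, mul_add]
          linarith

theorem exists_equiv_antitone {X : Type*} [Fintype X] {n : ℕ} (hcard : Fintype.card X = n)
    (w : X → ℝ) : ∃ e : Fin n ≃ X, Antitone (w ∘ e) := by
  let e₀ : Fin n ≃ X := (Fintype.equivFinOfCardEq hcard).symm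
  refine ⟨(Tuple.sort (fun i => -w (e₀ i))).trans e₀, fun i j hij => ?_⟩
  have h := Tuple.monotone_sort (fun i => -w (e₀ i)) hij
  simpa using h

/-- If every sum of entries of `x` is at most the sum of equally many largest entries of `y`, then
every nonnegative linear functional is at most as large on `x` as on some permutation of `y`. -/
theorem exists_perm_sum_mul_le {X : Type*} [Fintype X] {n : ℕ} (hcard : Fintype.card X = n)
    {x y : X → ℝ} (e : Fin n ≃ X)
    (h : ∀ S : Finset X, ∑ j ∈ S, x j ≤ ∑ i : Fin n, if (i : ℕ) < S.card then y (e i) else 0)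
    {w : X → ℝ} (hw : ∀ j, 0 ≤ w j) :
    ∃ σ : Equiv.Perm X, ∑ j, w j * x j ≤ ∑ j, w j * y (σ j) := by
  obtain ⟨e', he'⟩ := exists_equiv_antitone hcard w
  refine ⟨e'.symm.trans e, ?_⟩
  have key := mul_sum_le_sum_mul_of_antitone (d := fun i => y (e i) - x (e' i)) he'
    (fun l hl => by
      have h1 := h ((Finset.univ.filter fun i : Fin n => (i : ℕ) < l).map e'.toEmbedding)
      have hc : (Finset.univ.filter fun i : Fin n => (i : ℕ) < l).card = l := by
        rw [Fin.card_filter_val_lt]; omega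
      rw [Finset.card_map, hc, Finset.sum_map, Finset.sum_filter] at h1
      have h2 : ∑ i : Fin n, (if (i : ℕ) < l then y (e i) - x (e' i) else 0) =
          (∑ i : Fin n, if (i : ℕ) < l then y (e i) else 0) -
            ∑ i : Fin n, if (i : ℕ) < l then x (e' i) else 0 := by
        rw [← Finset.sum_sub_distrib]
        exact Finset.sum_congr rfl fun i _ => by split_ifs <;> simp
      rw [h2]
      exact sub_nonneg.2 h1)
    (c := 0) (fun i => hw _)
  rw [← e'.sum_comp, ← e'.sum_comp (fun j => w j * y _)]
  simp only [zero_mul, mul_sub, Finset.sum_sub_distrib, Function.comp_apply] at key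
  simpa using key

/-- Symmetric monotone norms respect weak majorization of nonnegative vectors. -/
theorem IsSymMonotoneNorm.le_of_sum_le {X : Type*} [Fintype X] {n : ℕ}
    (hcard : Fintype.card X = n) {f : (X → ℝ) → ℝ} (hf : IsSymMonotoneNorm f)
    {x y : X → ℝ} (hx : ∀ j, 0 ≤ x j) (e : Fin n ≃ X)
    (h : ∀ S : Finset X, ∑ j ∈ S, x j ≤ ∑ i : Fin n, if (i : ℕ) < S.card then y (e i) else 0) :
    f x ≤ f y := by
  classical
  obtain ⟨-, hsmul, hadd, hperm, hmono⟩ := hf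
  let P : Set (X → ℝ) := Set.range fun σ : Equiv.Perm X => y ∘ σ
  have hP : ∀ z ∈ convexHull ℝ P, f z ≤ f y := by
    refine convexHull_min (t := {z | f z ≤ f y}) ?_ ?_
    · rintro _ ⟨σ, rfl⟩
      exact (hperm σ y).le
    · intro u hu v hv a b ha hb hab
      have hu : f u ≤ f y := hu
      have hv : f v ≤ f y := hv
      change f (a • u + b • v) ≤ f y
      calc f (a • u + b • v) ≤ f (a • u) + f (b • v) := hadd _ _
        _ = a * f u + b * f v := by rw [hsmul, hsmul, abs_of_nonneg ha, abs_of_nonneg hb]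
        _ ≤ a * f y + b * f y := by gcongr
        _ = f y := by rw [← add_mul, hab, one_mul]
  by_cases hdis : Disjoint (convexHull ℝ P) (Set.Ici x)
  · exfalso
    obtain ⟨g, u, v, hgu, huv, hgv⟩ := geometric_hahn_banach_compact_closed
      (convex_convexHull ℝ P) ((Set.finite_range _).isCompact_convexHull ℝ) (convex_Ici x)
      isClosed_Ici hdis
    have hg : ∀ z : X → ℝ, g z = ∑ j, g (Pi.single j 1) * z j := by
      intro z
      have h1 := (g : (X → ℝ) →ₗ[ℝ] ℝ).pi_apply_eq_sum_univ z
      simp only [ContinuousLinearMap.coe_coe, smul_eq_mul] at h1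
      rw [h1]
      refine Finset.sum_congr rfl fun j _ => ?_
      rw [mul_comm]
      congr 2
      ext i
      simp [Pi.single_apply, eq_comm]
    have hw : ∀ j, 0 ≤ g (Pi.single j 1) := by
      intro j
      by_contra! hneg
      set c : ℝ := (g x - v) / -g (Pi.single j 1)
      have hgx : v < g x := hgv x (Set.mem_Ici.2 le_rfl)
      have hc : 0 ≤ c := div_nonneg (by linarith) (by linarith)
      have h1 := hgv (x + c • Pi.single j 1) (by
        refine Set.mem_Ici.2 (le_add_of_nonneg_right (smul_nonneg hc ?_))
        exact Pi.single_nonneg.2 zero_le_one)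
      rw [map_add, map_smul, smul_eq_mul] at h1
      have h2 : c * -g (Pi.single j 1) = g x - v := div_mul_cancel₀ _ (by linarith)
      linarith
    obtain ⟨σ, hσ⟩ := exists_perm_sum_mul_le hcard e h hw
    have h1 := hgu (y ∘ σ) (subset_convexHull ℝ P ⟨σ, rfl⟩)
    have h2 := hgv x (Set.mem_Ici.2 le_rfl)
    rw [hg] at h1 h2
    simp only [Function.comp_apply] at h1
    linarith
  · obtain ⟨z, hz, hxz⟩ := Set.not_disjoint_iff.1 hdis
    exact (hmono x z hx hxz).trans (hP z hz)

theorem distVec_nonneg {X : Type*} [MetricSpace X] (F : Finset X) (j : X) : 0 ≤ distVec F j :=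
  Real.sInf_nonneg (by rintro _ ⟨c, -, rfl⟩; exact dist_nonneg)

theorem distVec_anti {X : Type*} [MetricSpace X] {F C : Finset X} (hF : F.Nonempty)
    (hFC : F ⊆ C) (j : X) : distVec C j ≤ distVec F j :=
  csInf_le_csInf ⟨0, by rintro _ ⟨c, -, rfl⟩; exact dist_nonneg⟩
    ((Finset.coe_nonempty.2 hF).image _) (Set.image_mono (Finset.coe_subset.2 hFC))

/-- A value at most `T` is either approximated from above by one of the thresholds `T / r ^ i`,
or at most the last one. -/
theorem exists_threshold {r T t : ℝ} (hr : 0 < r) (ht : t ≤ T) (m : ℕ) :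
    (∃ i ≤ m, t ≤ T / r ^ i ∧ T / r ^ i ≤ r * t) ∨ t ≤ T / r ^ m := by
  induction m with
  | zero => right; simpa using ht
  | succ m ih =>
    rcases ih with ⟨i, hi, h⟩ | h
    · exact .inl ⟨i, by omega, h⟩
    · by_cases h' : t ≤ T / r ^ (m + 1)
      · exact .inr h'
      · refine .inl ⟨m, by omega, h, ?_⟩
        have h1 : T / r ^ m = r * (T / r ^ (m + 1)) := by field_simp; ring
        rw [h1]
        exact mul_le_mul_of_nonneg_left (not_le.1 h').le hr.le

/-- A sum of `l` entries is bounded through the excess over a threshold. -/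
theorem sum_le_card_mul_add_excess {X : Type*} [Fintype X] (x : X → ℝ) (S : Finset X) (t : ℝ) :
    ∑ j ∈ S, x j ≤ S.card * t + ∑ j, max (x j - t) 0 := by
  calc ∑ j ∈ S, x j ≤ ∑ j ∈ S, (t + max (x j - t) 0) :=
        Finset.sum_le_sum fun j _ => by linarith [le_max_left (x j - t) (0 : ℝ)]
    _ = S.card * t + ∑ j ∈ S, max (x j - t) 0 := by
        rw [Finset.sum_add_distrib, Finset.sum_const, nsmul_eq_mul]
    _ ≤ _ := add_le_add_right
        (Finset.sum_le_univ_sum_of_nonneg fun j => le_max_right (x j - t) (0 : ℝ)) _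

/-- The sum of the `l + 1` largest entries dominates the excess over a threshold which is at least
the smallest of these entries. -/
theorem card_mul_add_excess_le {X : Type*} [Fintype X] {n : ℕ} {y : X → ℝ} {e : Fin n ≃ X}
    (he : Antitone (y ∘ e)) (l : Fin n) {t : ℝ} (ht : y (e l) ≤ t) :
    ((l : ℕ) + 1 : ℝ) * y (e l) + ∑ j, max (y j - t) 0 ≤
      ∑ i : Fin n, if (i : ℕ) < l + 1 then y (e i) else 0 := by
  have h1 : ((l : ℕ) + 1 : ℝ) * y (e l) =
      ∑ i : Fin n, if (i : ℕ) < l + 1 then y (e l) else 0 := by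
    rw [← Finset.sum_filter, Finset.sum_const, Fin.card_filter_val_lt,
      min_eq_right (by omega), nsmul_eq_mul]
    push_cast
    rfl
  rw [h1, ← e.sum_comp, ← Finset.sum_add_distrib]
  refine Finset.sum_le_sum fun i _ => ?_
  split_ifs with hi
  · have h2 : y (e l) ≤ y (e i) := he (Fin.le_def.2 (by omega))
    rcases max_cases (y (e i) - t) 0 with h | h <;> linarith
  · have h2 : y (e i) ≤ y (e l) := he (Fin.le_def.2 (by omega))
    rw [max_eq_right (by linarith), zero_add]

/-- Theorem: simultaneous bicriteria (1+2ε)-approximation for k-Clustering. -/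
theorem stmt8 {X : Type*} [MetricSpace X] [Fintype X] (n : ℕ) (hn : 2 ≤ n)
    (hcard : Fintype.card X = n) (k : ℕ) (hk1 : 1 ≤ k) (hkn : k ≤ n)
    (ε : ℝ) (hε0 : 0 < ε) (hε1 : ε ≤ 1) :
    ∃ C : Finset X, C.Nonempty ∧
      (C.card : ℝ) ≤ (k : ℝ) * (1 + ((⌈Real.logb (1 + ε) ((n : ℝ) / ε)⌉ : ℤ) : ℝ)) ∧
      ∀ F : Finset X, F.Nonempty → F.card ≤ k →
        ∀ f : (X → ℝ) → ℝ, IsSymMonotoneNorm f →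
          f (distVec C) ≤ (1 + 2 * ε) * f (distVec F) := by
  classical
  have hr : (0 : ℝ) < 1 + ε := by linarith
  have hn0 : (0 : ℝ) < n := by positivity
  have hnε : 1 ≤ (n : ℝ) / ε := by
    rw [le_div_iff₀ hε0]
    have : (2 : ℝ) ≤ n := by exact_mod_cast hn
    linarith
  obtain ⟨x₀⟩ : Nonempty X := Fintype.card_pos_iff.1 (by omega)
  obtain ⟨m, hm⟩ : ∃ m : ℕ, ⌈Real.logb (1 + ε) ((n : ℝ) / ε)⌉ = (m : ℤ) :=
    Int.eq_ofNat_of_zero_le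
      (Int.ceil_nonneg (Real.logb_nonneg (by linarith) hnε))
  have hpow : (n : ℝ) / ε ≤ (1 + ε) ^ m := by
    have h1 : Real.logb (1 + ε) ((n : ℝ) / ε) ≤ m := by
      have h2 := Int.le_ceil (Real.logb (1 + ε) ((n : ℝ) / ε))
      rw [hm] at h2
      exact_mod_cast h2
    rw [Real.logb_le_iff_le_rpow (by linarith) (by positivity)] at h1
    simpa using h1
  let Cand : Finset (Finset X) := Finset.univ.filter fun F => F.Nonempty ∧ F.card ≤ k
  have hCand : Cand.Nonempty := ⟨{x₀}, by simp [Cand, hk1]⟩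
  have hmem : ∀ F, F ∈ Cand ↔ F.Nonempty ∧ F.card ≤ k := fun F => by simp [Cand]
  have huniv : (Finset.univ : Finset X).Nonempty := ⟨x₀, Finset.mem_univ _⟩
  obtain ⟨Fc, hFc, hFcmin⟩ := Cand.exists_min_image
    (fun F => Finset.univ.sup' huniv (distVec F)) hCand
  set T : ℝ := Finset.univ.sup' huniv (distVec Fc) with hT
  have hT0 : 0 ≤ T := (distVec_nonneg Fc x₀).trans
    (Finset.le_sup' (distVec Fc) (Finset.mem_univ x₀))
  choose G hG hGmin using fun i : ℕ => Cand.exists_min_image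
    (fun F => ∑ j, max (distVec F j - T / (1 + ε) ^ i) 0) hCand
  let C : Finset X := (Finset.range (m + 1)).biUnion G
  have hGC : ∀ i ≤ m, ∀ j, distVec C j ≤ distVec (G i) j := fun i hi =>
    distVec_anti ((hmem _).1 (hG i)).1
      (Finset.subset_biUnion_of_mem G (Finset.mem_range.2 (by omega)))
  have hexc : ∀ F ∈ Cand, ∀ i ≤ m, ∑ j, max (distVec C j - T / (1 + ε) ^ i) 0 ≤
      ∑ j, max (distVec F j - T / (1 + ε) ^ i) 0 := by
    intro F hF i hi
    refine le_trans (Finset.sum_le_sum fun j _ => ?_) (hGmin i F hF)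
    exact max_le_max_right _ (sub_le_sub_right (hGC i hi j) _)
  have hCT : ∀ j, distVec C j ≤ T := by
    intro j
    have h1 := hexc Fc hFc 0 (Nat.zero_le _)
    have h2 : ∑ j, max (distVec Fc j - T / (1 + ε) ^ 0) 0 = 0 :=
      Finset.sum_eq_zero fun i _ => max_eq_right (by
        have := Finset.le_sup' (distVec Fc) (Finset.mem_univ i)
        simp only [pow_zero, div_one]
        linarith)
    have h3 := Finset.single_le_sum (f := fun j => max (distVec C j - T / (1 + ε) ^ 0) 0)
      (fun i _ => le_max_right _ _) (Finset.mem_univ j)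
    have h4 := le_max_left (distVec C j - T / (1 + ε) ^ 0) 0
    simp only [pow_zero, div_one] at h1 h2 h3 h4
    linarith
  refine ⟨C, ?_, ?_, ?_⟩
  · exact ((hmem _).1 (hG 0)).1.mono
      (Finset.subset_biUnion_of_mem G (Finset.mem_range.2 (by omega)))
  · have h1 : C.card ≤ (m + 1) * k := by
      simpa using Finset.card_biUnion_le_card_mul (Finset.range (m + 1)) G k
        fun i _ => ((hmem _).1 (hG i)).2
    have h2 : (C.card : ℝ) ≤ (m + 1) * k := by exact_mod_cast h1
    rw [hm]
    push_cast
    linarith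
  intro F hF hFk f hf
  have hFC : F ∈ Cand := (hmem F).2 ⟨hF, hFk⟩
  have hsmul : f ((1 + 2 * ε) • distVec F) = (1 + 2 * ε) * f (distVec F) := by
    rw [hf.2.1, abs_of_pos (by linarith)]
  rw [← hsmul]
  obtain ⟨e, he⟩ := exists_equiv_antitone hcard (distVec F)
  refine IsSymMonotoneNorm.le_of_sum_le hcard hf (distVec_nonneg C) e fun S => ?_
  rcases hS : S.card with _ | l
  · rw [Finset.card_eq_zero.1 hS]
    simp
  have hl : l < n := by
    have := S.card_le_univ
    omega
  have hSn : ((l : ℝ) + 1) ≤ n := by exact_mod_cast hl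
  set top : ℝ := ∑ i : Fin n, if (i : ℕ) < l + 1 then distVec F (e i) else 0 with htop
  have hgoal : (∑ i : Fin n, if (i : ℕ) < l + 1 then ((1 + 2 * ε) • distVec F) (e i) else 0) =
      (1 + 2 * ε) * top := by
    simp [htop, Finset.mul_sum]
  rw [hgoal]
  have hexcF : ∀ t, distVec F (e ⟨l, hl⟩) ≤ t →
      ((l : ℝ) + 1) * distVec F (e ⟨l, hl⟩) + ∑ j, max (distVec F j - t) 0 ≤ top :=
    fun t ht => card_mul_add_excess_le he ⟨l, hl⟩ ht
  have hexcC : ∀ t, ∑ j ∈ S, distVec C j ≤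
      ((l : ℝ) + 1) * t + ∑ j, max (distVec C j - t) 0 := fun t => by
    have := sum_le_card_mul_add_excess (distVec C) S t
    rw [hS] at this
    exact_mod_cast this
  set t₀ : ℝ := distVec F (e ⟨l, hl⟩) with ht₀
  have ht₀0 : 0 ≤ t₀ := distVec_nonneg _ _
  have hl0 : (0 : ℝ) ≤ (l : ℝ) + 1 := by positivity
  have hlt : ((l : ℝ) + 1) * t₀ ≤ top := by
    have h1 := hexcF t₀ le_rfl
    have h2 : 0 ≤ ∑ j, max (distVec F j - t₀) 0 := Finset.sum_nonneg fun j _ => le_max_right _ _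
    linarith
  have htop0 : 0 ≤ top := (mul_nonneg hl0 ht₀0).trans hlt
  have hεtop : 0 ≤ ε * top := mul_nonneg hε0.le htop0
  rcases lt_or_ge T t₀ with hTt | htT
  · have h1 := hexcC T
    have h2 : ∑ j, max (distVec C j - T) 0 = 0 :=
      Finset.sum_eq_zero fun j _ => max_eq_right (by linarith [hCT j])
    have h3 := mul_le_mul_of_nonneg_left hTt.le hl0
    linarith
  rcases exists_threshold hr htT m with ⟨i, hi, hti, hit⟩ | htm
  · have h1 := hexcC (T / (1 + ε) ^ i)
    have h2 := hexc F hFC i hi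
    have h3 := hexcF _ hti
    have h4 := mul_le_mul_of_nonneg_left hit hl0
    have h5 := mul_le_mul_of_nonneg_left hlt hε0.le
    linarith
  · have h1 := hexcC (T / (1 + ε) ^ m)
    have h2 := hexc F hFC m le_rfl
    have h3 := hexcF _ htm
    have h4 : ((l : ℝ) + 1) * (T / (1 + ε) ^ m) ≤ ε * T := by
      have h5 : (n : ℝ) ≤ (1 + ε) ^ m * ε := (div_le_iff₀ hε0).1 hpow
      rw [← mul_div_assoc, div_le_iff₀ (by positivity)]
      nlinarith
    have h5 : T ≤ top := by
      refine (hFcmin F hFC).trans (Finset.sup'_le _ _ fun j _ => ?_)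
      have h6 : distVec F j ≤ distVec F (e ⟨0, by omega⟩) := by
        have := he (a := ⟨0, by omega⟩) (b := e.symm j) (Fin.le_def.2 (Nat.zero_le _))
        simpa using this
      refine h6.trans ?_
      have h7 := Finset.single_le_sum
        (f := fun i : Fin n => if (i : ℕ) < l + 1 then distVec F (e i) else 0)
        (fun i _ => by split_ifs; exacts [distVec_nonneg _ _, le_rfl])
        (Finset.mem_univ (⟨0, by omega⟩ : Fin n))
      simpa only [Nat.zero_lt_succ, if_true] using h7
    have h6 := mul_le_mul_of_nonneg_left h5 hε0.le
    have h7 := mul_nonneg hl0 ht₀0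
    linarith
end

section
/- Let w ∈ ℝ^d be a weight vector. Then the dual norm of the ordered norm ‖·‖_(w), defined by ‖y‖*_(w) = sup{ yᵀx : x ∈ ℝ^d, ‖x‖_(w) ≤ 1 }, satisfies ‖y‖*_(w) = max_{k∈{1,…,d}} ‖y‖_{(k)} / ‖w‖_{(k)} for every y ∈ ℝ^d. -/
/-- Any decreasing rearrangement of `|x|` is the decreasing rearrangement. -/
theorem absSortDesc_eq_of_antitone {d : ℕ} (x : Fin d → ℝ) (ρ : Equiv.Perm (Fin d))
    (h : Antitone fun k => |x (ρ k)|) : absSortDesc x = fun k => |x (ρ k)| := by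
  have hmono : Monotone ((fun i => |x i|) ∘ (Fin.revPerm.trans ρ)) :=
    fun a b hab => h (Fin.rev_le_rev.mpr hab)
  have hsort := Tuple.comp_sort_eq_comp_iff_monotone.mpr hmono
  funext k
  have hk := congrFun hsort k.rev
  simpa [absSortDesc] using hk.symm

theorem absSortDesc_antitone {d : ℕ} (x : Fin d → ℝ) : Antitone (absSortDesc x) :=
  fun _ _ hab => Tuple.monotone_sort (fun i => |x i|) (Fin.rev_le_rev.mpr hab)

theorem absSortDesc_nonneg {d : ℕ} (x : Fin d → ℝ) (k : Fin d) : 0 ≤ absSortDesc x k :=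
  abs_nonneg _

theorem IsWeightVector.absSortDesc_eq {d : ℕ} {w : Fin d → ℝ} (hw : IsWeightVector w) :
    absSortDesc w = w := by
  have habs : (fun k => |w k|) = w := funext fun k => abs_of_nonneg (hw.2.1 k)
  rw [absSortDesc_eq_of_antitone w 1 (by simpa [habs] using hw.1)]
  simpa using habs

theorem IsWeightVector.topkNorm_pos {d : ℕ} {w : Fin d → ℝ} (hw : IsWeightVector w)
    (k : ℕ) : 0 < topkNorm (k + 1) w := by
  obtain ⟨i, hi⟩ := Function.ne_iff.mp hw.2.2
  have hpos : 0 < w i := lt_of_le_of_ne (hw.2.1 i) (Ne.symm hi)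
  have hd : 0 < d := i.pos
  rw [topkNorm, hw.absSortDesc_eq]
  refine Finset.sum_pos' (fun j _ => hw.2.1 j) ⟨⟨0, hd⟩, by simp, ?_⟩
  exact hpos.trans_le (hw.1 (Fin.mk_le_of_le_val (Nat.zero_le _)))

/-- The rearrangement inequality for decreasing rearrangements of absolute values. -/
theorem sum_mul_le_sum_absSortDesc_mul {d : ℕ} (x y : Fin d → ℝ) :
    ∑ i, y i * x i ≤ ∑ k, absSortDesc y k * absSortDesc x k := by
  set ρ : Equiv.Perm (Fin d) := Fin.revPerm.trans (Tuple.sort fun i => |x i|)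
  set τ : Equiv.Perm (Fin d) := Fin.revPerm.trans (Tuple.sort fun i => |y i|)
  have hx : ∀ k, absSortDesc x k = |x (ρ k)| := fun _ => rfl
  have hy : ∀ k, absSortDesc y k = |y (τ k)| := fun _ => rfl
  have hmono : Monovary (absSortDesc y) (absSortDesc x) :=
    (absSortDesc_antitone y).monovary (absSortDesc_antitone x)
  calc ∑ i, y i * x i ≤ ∑ i, |y i| * |x i| :=
        Finset.sum_le_sum fun i _ => (le_abs_self _).trans (abs_mul _ _).le
    _ = ∑ k, absSortDesc y k * absSortDesc x ((τ.trans ρ.symm) k) := by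
        rw [← Equiv.sum_comp τ]
        simp [hx, hy]
    _ ≤ _ := hmono.sum_mul_comp_perm_le_sum_mul

/-- Abel summation: a sequence with nonnegative partial sums stays nonnegative when summed
against decreasing multipliers, up to the smallest multiplier. -/
theorem mul_sum_range_le_sum_range_mul {a c : ℕ → ℝ} (ha : Antitone a) (n : ℕ)
    (hc : ∀ k ≤ n, 0 ≤ ∑ i ∈ Finset.range k, c i) :
    a n * ∑ i ∈ Finset.range n, c i ≤ ∑ i ∈ Finset.range n, a i * c i := by
  induction n with
  | zero => simp
  | succ n ih =>
    have hle := ih fun k hk => hc k (hk.trans n.le_succ)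
    have hsum := mul_le_mul_of_nonneg_right (ha n.le_succ) (hc (n + 1) le_rfl)
    rw [Finset.sum_range_succ] at hsum ⊢
    rw [Finset.sum_range_succ]
    linarith

theorem sum_mul_nonneg_of_antitone {d : ℕ} {a c : Fin d → ℝ} (ha : Antitone a)
    (ha₀ : ∀ k, 0 ≤ a k)
    (hc : ∀ k : Fin d, 0 ≤ ∑ i ∈ Finset.univ.filter (fun i : Fin d => (i : ℕ) < k + 1), c i) :
    0 ≤ ∑ k, a k * c k := by
  set a' : ℕ → ℝ := fun i => if h : i < d then a ⟨i, h⟩ else 0 with ha'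
  set c' : ℕ → ℝ := fun i => if h : i < d then c ⟨i, h⟩ else 0 with hc'
  have hanti : Antitone a' := by
    intro i j hij
    by_cases hj : j < d
    · simpa [ha', hj, hij.trans_lt hj] using ha (Fin.mk_le_mk.mpr hij)
    · by_cases hi : i < d
      · simpa [ha', hi, hj] using ha₀ ⟨i, hi⟩
      · simp [ha', hi, hj]
  have hpre : ∀ k ≤ d, 0 ≤ ∑ i ∈ Finset.range k, c' i := by
    intro k hk
    rcases k with _ | k
    · simp
    · refine (hc ⟨k, hk⟩).trans_eq ?_
      refine Finset.sum_bij (fun i _ => (i : ℕ)) (by simp) (fun i _ j _ h => Fin.ext h) ?_ ?_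
      · intro j hj
        have hj' := Finset.mem_range.mp hj
        exact ⟨⟨j, hj'.trans_le hk⟩, by simpa using hj', rfl⟩
      · intro i _
        simp [hc']
  have h := mul_sum_range_le_sum_range_mul hanti d hpre
  have hd : a' d = 0 := by simp [ha']
  rw [hd, zero_mul, Finset.sum_range] at h
  simpa [ha', hc'] using h

theorem sum_mul_le_of_topkNorm_le {d : ℕ} {w : Fin d → ℝ} (hw : IsWeightVector w)
    (x y : Fin d → ℝ) (M : ℝ)
    (hM : ∀ k : Fin d, topkNorm ((k : ℕ) + 1) y ≤ M * topkNorm ((k : ℕ) + 1) w) :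
    ∑ i, y i * x i ≤ M * orderedNorm w x := by
  refine (sum_mul_le_sum_absSortDesc_mul x y).trans ?_
  have h := sum_mul_nonneg_of_antitone (a := absSortDesc x)
    (c := fun k => M * w k - absSortDesc y k) (absSortDesc_antitone x) (absSortDesc_nonneg x) ?_
  · rw [orderedNorm, Finset.mul_sum, ← sub_nonneg, ← Finset.sum_sub_distrib]
    refine h.trans_eq (Finset.sum_congr rfl fun k _ => by ring)
  · intro k
    have hk := hM k
    rw [topkNorm, topkNorm, hw.absSortDesc_eq, Finset.mul_sum] at hk
    rw [Finset.sum_sub_distrib]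
    exact sub_nonneg.mpr hk

/-- Each ratio of top-`k` norms is attained on the unit ball, at a vector supported on the `k`
largest entries of `|y|`. -/
theorem exists_orderedNorm_le_one_of_topkNorm {d : ℕ} {w : Fin d → ℝ} (hw : IsWeightVector w)
    (y : Fin d → ℝ) (k : ℕ) :
    ∃ x : Fin d → ℝ, orderedNorm w x ≤ 1 ∧
      topkNorm (k + 1) y / topkNorm (k + 1) w = ∑ i, y i * x i := by
  have hW := hw.topkNorm_pos k
  set W := topkNorm (k + 1) w with hWdef
  set ρ : Equiv.Perm (Fin d) := Fin.revPerm.trans (Tuple.sort fun i => |y i|)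
  have hy : ∀ j, absSortDesc y j = |y (ρ j)| := fun _ => rfl
  let x : Fin d → ℝ := fun i =>
    if ((ρ.symm i : Fin d) : ℕ) < k + 1 then (if y i < 0 then -W⁻¹ else W⁻¹) else 0
  have habs : (fun j => |x (ρ j)|) = fun j : Fin d => if (j : ℕ) < k + 1 then W⁻¹ else 0 := by
    funext j
    simp only [x, Equiv.symm_apply_apply]
    split_ifs <;> simp [abs_of_pos hW]
  have hanti : Antitone fun j => |x (ρ j)| := by
    rw [habs]
    intro i j hij
    have hij' : (i : ℕ) ≤ j := hij
    have hWi := (inv_pos.mpr hW).le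
    dsimp only
    split_ifs <;> first | omega | exact le_rfl
  refine ⟨x, le_of_eq ?_, ?_⟩
  · rw [orderedNorm, absSortDesc_eq_of_antitone x ρ hanti, habs]
    simp only [mul_ite, mul_zero]
    rw [← Finset.sum_filter, ← Finset.sum_mul]
    rw [topkNorm, hw.absSortDesc_eq] at hWdef
    rw [← hWdef, mul_inv_cancel₀ hW.ne']
  · rw [topkNorm, div_eq_mul_inv, Finset.sum_mul, Finset.sum_filter,
      ← Equiv.sum_comp ρ fun i => y i * x i]
    refine Finset.sum_congr rfl fun j _ => ?_
    simp only [x, Equiv.symm_apply_apply, hy]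
    split_ifs with h₁ h₂
    · rw [abs_of_neg h₂]; ring
    · rw [abs_of_nonneg (not_lt.mp h₂)]
    · simp

/-- Lemma (dual ordered norms). -/
theorem stmt11 {d : ℕ} (hd : 1 ≤ d) (w : Fin d → ℝ) (hw : IsWeightVector w)
    (y : Fin d → ℝ) :
    dualOrderedNorm w y =
      ⨆ k : Fin d, topkNorm ((k : ℕ) + 1) y / topkNorm ((k : ℕ) + 1) w := by
  have : Nonempty (Fin d) := ⟨⟨0, hd⟩⟩
  set M := ⨆ k : Fin d, topkNorm ((k : ℕ) + 1) y / topkNorm ((k : ℕ) + 1) w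
  have hle : ∀ k : Fin d, topkNorm ((k : ℕ) + 1) y / topkNorm ((k : ℕ) + 1) w ≤ M :=
    le_ciSup (Set.finite_range _).bddAbove
  have hM : 0 ≤ M :=
    (div_nonneg (Finset.sum_nonneg fun i _ => absSortDesc_nonneg y i)
      (hw.topkNorm_pos _).le).trans (hle ⟨0, hd⟩)
  have hub : ∀ r ∈ {r : ℝ | ∃ x : Fin d → ℝ, orderedNorm w x ≤ 1 ∧ r = ∑ i, y i * x i},
      r ≤ M := by
    rintro r ⟨x, hx, rfl⟩
    refine (sum_mul_le_of_topkNorm_le hw x y M fun k => ?_).trans (mul_le_of_le_one_right hM hx)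
    exact (div_le_iff₀ (hw.topkNorm_pos _)).mp (hle k)
  refine le_antisymm (csSup_le ?_ hub) (ciSup_le fun k => le_csSup ⟨M, hub⟩ ?_)
  · exact ⟨_, exists_orderedNorm_le_one_of_topkNorm hw y 0⟩
  · exact exists_orderedNorm_le_one_of_topkNorm hw y k
end

section
/- There exists an absolute constant C such that for every d ≥ 2, every ε ∈ (0,1], and every nonempty compact set D ⊆ ℝ_{≥0}^d, there exists a finite subset X ⊆ D with |X| ≤ d^{C/ε} such that for every symmetric monotonic norm ‖·‖_f on ℝ^d, min_{x∈X} ‖x‖_f ≤ (1+ε)·min_{x∈D} ‖x‖_f. -/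
/-- A permutation sorting the coordinates of `x` in decreasing order. -/
noncomputable def descPerm {d : ℕ} (x : Fin d → ℝ) : Equiv.Perm (Fin d) :=
  Tuple.sort fun i => -x i

/-- The coordinates of `x` in decreasing order, extended by zero. -/
noncomputable def descSeq {d : ℕ} (x : Fin d → ℝ) (k : ℕ) : ℝ :=
  if h : k < d then x (descPerm x ⟨k, h⟩) else 0

/-- The sum of the `m` largest coordinates of `x`. -/
noncomputable def topSum {d : ℕ} (x : Fin d → ℝ) (m : ℕ) : ℝ :=
  ∑ k ∈ Finset.range m, descSeq x k

theorem antitone_comp_descPerm {d : ℕ} (x : Fin d → ℝ) : Antitone (x ∘ descPerm x) := by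
  intro i j hij
  have h := Tuple.monotone_sort (fun i => -x i) hij
  simpa [descPerm] using h

theorem descSeq_nonneg {d : ℕ} {x : Fin d → ℝ} (hx : ∀ i, 0 ≤ x i) (k : ℕ) :
    0 ≤ descSeq x k := by
  unfold descSeq
  split_ifs
  · exact hx _
  · exact le_rfl

theorem antitone_descSeq {d : ℕ} {x : Fin d → ℝ} (hx : ∀ i, 0 ≤ x i) :
    Antitone (descSeq x) := by
  intro i j hij
  by_cases hj : j < d
  · have hi : i < d := hij.trans_lt hj
    simp only [descSeq, hi, hj, dif_pos]
    exact antitone_comp_descPerm x (show (⟨i, hi⟩ : Fin d) ≤ ⟨j, hj⟩ from hij)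
  · rw [show descSeq x j = 0 by simp [descSeq, hj]]
    exact descSeq_nonneg hx i

theorem descSeq_fin {d : ℕ} (x : Fin d → ℝ) (i : Fin d) :
    descSeq x i = x (descPerm x i) := by
  simp [descSeq]

theorem topSum_mono {d : ℕ} {x : Fin d → ℝ} (hx : ∀ i, 0 ≤ x i) : Monotone (topSum x) := by
  intro m n hmn
  exact Finset.sum_le_sum_of_subset_of_nonneg (by simpa using hmn)
    fun k _ _ => descSeq_nonneg hx k

theorem topSum_nonneg {d : ℕ} {x : Fin d → ℝ} (hx : ∀ i, 0 ≤ x i) (m : ℕ) : 0 ≤ topSum x m :=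
  Finset.sum_nonneg fun k _ => descSeq_nonneg hx k

theorem le_topSum_one {d : ℕ} {x : Fin d → ℝ} (hx : ∀ i, 0 ≤ x i) (i : Fin d) :
    x i ≤ topSum x 1 := by
  have h := descSeq_fin x ((descPerm x).symm i)
  rw [Equiv.apply_symm_apply] at h
  rw [← h]
  simpa [topSum] using antitone_descSeq hx (Nat.zero_le _)

theorem norm_le_topSum {d : ℕ} {x : Fin d → ℝ} (hx : ∀ i, 0 ≤ x i) {m : ℕ} (hm : 1 ≤ m) :
    ‖x‖ ≤ topSum x m := by
  refine (pi_norm_le_iff_of_nonneg (topSum_nonneg hx m)).2 fun i => ?_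
  rw [Real.norm_of_nonneg (hx i)]
  exact (le_topSum_one hx i).trans (topSum_mono hx hm)

theorem topSum_le_mul_norm {d : ℕ} (x : Fin d → ℝ) (m : ℕ) : topSum x m ≤ d * ‖x‖ := by
  have h1 : ∀ k ∈ Finset.range m, descSeq x k ≤ if k < d then ‖x‖ else 0 := by
    intro k _
    unfold descSeq
    split_ifs with h
    · exact (le_abs_self _).trans (norm_le_pi_norm x _)
    · exact le_rfl
  refine (Finset.sum_le_sum h1).trans ?_
  rw [← Finset.sum_filter, Finset.sum_const, nsmul_eq_mul]
  refine mul_le_mul_of_nonneg_right ?_ (norm_nonneg x)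
  have : (Finset.range m).filter (fun k => k < d) ⊆ Finset.range d := by
    intro k hk
    simpa using (Finset.mem_filter.1 hk).2
  exact_mod_cast (Finset.card_le_card this).trans (Finset.card_range d).le

theorem topSum_of_le {d : ℕ} (x : Fin d → ℝ) {m : ℕ} (hm : d ≤ m) :
    topSum x m = topSum x d := by
  refine (Finset.sum_subset (by simpa using hm) fun k _ hk => ?_).symm
  simp only [Finset.mem_range] at hk
  simp [descSeq, hk]

theorem mul_topSum_le {d : ℕ} {x : Fin d → ℝ} (hx : ∀ i, 0 ≤ x i) {m n : ℕ} (hmn : m ≤ n) :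
    m * topSum x n ≤ n * topSum x m := by
  have h1 : m * descSeq x m ≤ topSum x m := by
    have := Finset.card_nsmul_le_sum (Finset.range m) (descSeq x) (descSeq x m)
      fun k hk => antitone_descSeq hx (Finset.mem_range.1 hk).le
    simpa [topSum] using this
  induction n, hmn using Nat.le_induction with
  | base => exact le_rfl
  | succ n hn ih =>
    have h2 : topSum x (n + 1) = topSum x n + descSeq x n := Finset.sum_range_succ _ _
    have h3 : (m : ℝ) * descSeq x n ≤ m * descSeq x m :=
      mul_le_mul_of_nonneg_left (antitone_descSeq hx hn) (Nat.cast_nonneg m)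
    push_cast
    rw [h2]
    linarith

theorem sum_mul_nonneg_of_partial_sums {b u : ℕ → ℝ} (hb : Antitone b) (hb0 : ∀ k, 0 ≤ b k)
    (hu : ∀ m, 0 ≤ ∑ k ∈ Finset.range m, u k) (n : ℕ) :
    0 ≤ ∑ k ∈ Finset.range n, b k * u k := by
  have key : ∀ n, b n * ∑ k ∈ Finset.range (n + 1), u k ≤
      ∑ k ∈ Finset.range (n + 1), b k * u k := by
    intro n
    induction n with
    | zero => simp
    | succ n ih =>
      rw [Finset.sum_range_succ (n := n + 1), Finset.sum_range_succ (n := n + 1)]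
      have := mul_le_mul_of_nonneg_right (hb n.le_succ) (hu (n + 1))
      linarith
  cases n with
  | zero => simp
  | succ n => exact (mul_nonneg (hb0 n) (hu _)).trans (key n)

theorem sum_mul_le_of_topSum_le {d : ℕ} {w x z : Fin d → ℝ} {c : ℝ} (hw : ∀ i, 0 ≤ w i)
    (h : ∀ m, topSum x m ≤ c * topSum z m) :
    ∃ σ : Equiv.Perm (Fin d), ∑ i, w i * x i ≤ c * ∑ i, w i * z (σ i) := by
  refine ⟨(descPerm w).symm.trans (descPerm z), ?_⟩
  have h1 : ∑ i, w i * x i ≤ ∑ i, w (descPerm w i) * x (descPerm x i) := by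
    have hmono : Monovary (w ∘ descPerm w) (x ∘ descPerm x) :=
      (antitone_comp_descPerm w).monovary (antitone_comp_descPerm x)
    have := hmono.sum_mul_comp_perm_le_sum_mul (σ := (descPerm w).trans (descPerm x).symm)
    rw [← Equiv.sum_comp (descPerm w)]
    simpa using this
  have h2 : ∑ i, w i * z (((descPerm w).symm.trans (descPerm z)) i) =
      ∑ i, w (descPerm w i) * z (descPerm z i) := by
    rw [← Equiv.sum_comp (descPerm w)]
    simp
  have h3 := sum_mul_nonneg_of_partial_sums (antitone_descSeq hw) (descSeq_nonneg hw)
    (u := fun k => c * descSeq z k - descSeq x k) (fun m => by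
      rw [Finset.sum_sub_distrib, ← Finset.mul_sum]
      exact sub_nonneg.2 (h m)) d
  rw [Finset.sum_range] at h3
  simp only [descSeq_fin] at h3
  have h4 : ∑ i, w (descPerm w i) * (c * z (descPerm z i) - x (descPerm x i)) =
      c * ∑ i, w (descPerm w i) * z (descPerm z i) -
        ∑ i, w (descPerm w i) * x (descPerm x i) := by
    rw [Finset.mul_sum, ← Finset.sum_sub_distrib]
    exact Finset.sum_congr rfl fun i _ => by ring
  rw [h2]
  linarith

theorem IsSymMonotoneNorm.exists_support {ι : Type*} [Fintype ι] {f : (ι → ℝ) → ℝ}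
    (hf : IsSymMonotoneNorm f) {x : ι → ℝ} (hx : x ≠ 0) :
    ∃ g : (ι → ℝ) →ₗ[ℝ] ℝ, g x = f x ∧ ∀ y, g y ≤ f y := by
  obtain ⟨hf0, hfs, hfa, -, -⟩ := hf
  obtain ⟨g, hg1, hg2⟩ := exists_extension_of_le_sublinear
    (LinearPMap.mkSpanSingleton x (f x) hx) f
    (fun c hc y => by rw [hfs, abs_of_pos hc]) hfa (by
      rintro ⟨y, hy⟩
      obtain ⟨a, rfl⟩ := Submodule.mem_span_singleton.1 hy
      have hnonneg : 0 ≤ f x := by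
        have h := hfa x ((-1 : ℝ) • x)
        rw [hfs, neg_one_smul, add_neg_cancel, (hf0 0).2 rfl] at h
        norm_num at h
        linarith
      refine (LinearPMap.mkSpanSingleton'_apply (σ := RingHom.id ℝ) x (f x) _ a hy).trans_le ?_
      rw [hfs]
      exact mul_le_mul_of_nonneg_right (le_abs_self a) hnonneg)
  refine ⟨g, ?_, hg2⟩
  have h := hg1 ⟨x, Submodule.mem_span_singleton_self x⟩
  exact h.trans (LinearPMap.mkSpanSingleton_apply ℝ ℝ hx (f x))

theorem IsSymMonotoneNorm.le_mul_of_topSum_le {d : ℕ} {f : (Fin d → ℝ) → ℝ}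
    (hf : IsSymMonotoneNorm f) {x z : Fin d → ℝ} {c : ℝ} (hc : 0 ≤ c)
    (hx : ∀ i, 0 ≤ x i) (hz : ∀ i, 0 ≤ z i) (h : ∀ m, topSum x m ≤ c * topSum z m) :
    f x ≤ c * f z := by
  have hfz : 0 ≤ f z := by
    have := hf.2.2.2.2 0 z (fun _ => le_rfl) hz
    rwa [(hf.1 0).2 rfl] at this
  by_cases hx0 : x = 0
  · rw [(hf.1 x).2 hx0]
    positivity
  obtain ⟨g, hgx, hg⟩ := hf.exists_support hx0
  set v : Fin d → ℝ := fun i => g (Pi.single i 1) with hv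
  have hgsum : ∀ y, g y = ∑ i, v i * y i := by
    intro y
    rw [LinearMap.pi_apply_eq_sum_univ g y]
    refine Finset.sum_congr rfl fun i _ => ?_
    have : (fun j => if i = j then (1 : ℝ) else 0) = Pi.single i 1 := by
      ext j
      simp [Pi.single_apply, eq_comm]
    rw [this, smul_eq_mul, mul_comm]
  obtain ⟨σ, hσ⟩ := sum_mul_le_of_topSum_le (w := fun i => max (v i) 0)
    (fun i => le_max_right _ _) h
  have hmask : ∑ i, max (v i) 0 * z (σ i) ≤ f z := by
    have h1 : ∑ i, max (v i) 0 * z (σ i) = g fun i => if 0 ≤ v i then z (σ i) else 0 := by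
      rw [hgsum]
      refine Finset.sum_congr rfl fun i _ => ?_
      split_ifs with hi
      · rw [max_eq_left hi]
      · rw [max_eq_right (not_le.1 hi).le, zero_mul, mul_zero]
    rw [h1, ← hf.2.2.2.1 σ z]
    refine (hg _).trans (hf.2.2.2.2 _ _ (fun i => ?_) fun i => ?_)
    · split_ifs
      · exact hz _
      · exact le_rfl
    · dsimp only [Function.comp]
      split_ifs
      · exact le_rfl
      · exact hz _
  calc f x = ∑ i, v i * x i := by rw [← hgx, hgsum]
    _ ≤ ∑ i, max (v i) 0 * x i :=
      Finset.sum_le_sum fun i _ => mul_le_mul_of_nonneg_right (le_max_left _ _) (hx i)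
    _ ≤ c * ∑ i, max (v i) 0 * z (σ i) := hσ
    _ ≤ c * f z := mul_le_mul_of_nonneg_left hmask hc

/-- It suffices to compare `topSum` at the rounded powers of `1 + δ`. -/
theorem topSum_le_of_le_at_powers {d : ℕ} {x y : Fin d → ℝ} {δ : ℝ} (hδ : 0 < δ)
    (hx : ∀ i, 0 ≤ x i) (hy : ∀ i, 0 ≤ y i)
    (h : ∀ j : ℕ, (1 + δ) ^ j ≤ d →
      topSum x ⌈(1 + δ) ^ j⌉₊ ≤ (1 + δ) * topSum y ⌈(1 + δ) ^ j⌉₊) (m : ℕ) :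
    topSum x m ≤ (1 + δ) ^ 2 * topSum y m := by
  wlog hmd : m ≤ d generalizing m
  · rw [topSum_of_le x (not_le.1 hmd).le, topSum_of_le y (not_le.1 hmd).le]
    exact this d le_rfl
  rcases Nat.eq_zero_or_pos m with rfl | hm
  · simp [topSum]
  obtain ⟨j, hj1, hj2⟩ := exists_nat_pow_near (x := (m : ℝ)) (y := 1 + δ)
    (by exact_mod_cast hm) (by linarith)
  have hkm : ⌈(1 + δ) ^ j⌉₊ ≤ m := Nat.ceil_le.2 hj1
  have hjd : (1 + δ) ^ j ≤ d := hj1.trans (by exact_mod_cast hmd)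
  have hk : (1 + δ) ^ j ≤ (⌈(1 + δ) ^ j⌉₊ : ℝ) := Nat.le_ceil _
  set k := ⌈(1 + δ) ^ j⌉₊
  have hk0 : (0 : ℝ) < k := lt_of_lt_of_le (by positivity) hk
  have hmk : (m : ℝ) ≤ (1 + δ) * k := by
    rw [pow_succ] at hj2
    nlinarith
  have h1 : k * topSum x m ≤ k * ((1 + δ) * topSum x k) := by
    calc k * topSum x m ≤ m * topSum x k := mul_topSum_le hx hkm
      _ ≤ (1 + δ) * k * topSum x k := mul_le_mul_of_nonneg_right hmk (topSum_nonneg hx k)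
      _ = _ := by ring
  calc topSum x m ≤ (1 + δ) * topSum x k := le_of_mul_le_mul_left h1 hk0
    _ ≤ (1 + δ) * ((1 + δ) * topSum y k) := mul_le_mul_of_nonneg_left (h j hjd) (by linarith)
    _ ≤ (1 + δ) * ((1 + δ) * topSum y m) := by
      have := topSum_mono hy hkm
      gcongr
    _ = _ := by ring

theorem eq_of_image_add_id_eq {s t : ℕ → ℕ} (hs : Monotone s) (ht : Monotone t) {n : ℕ}
    (h : (Finset.range n).image (fun j => s j + j) = (Finset.range n).image fun j => t j + j)
    {j : ℕ} (hj : j < n) : s j = t j := by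
  have hs' : StrictMono fun i : Fin n => s i + i := fun a b hab =>
    add_lt_add_of_le_of_lt (hs hab.le) hab
  have ht' : StrictMono fun i : Fin n => t i + i := fun a b hab =>
    add_lt_add_of_le_of_lt (ht hab.le) hab
  have hr : Set.range (fun i : Fin n => s i + i) = Set.range fun i : Fin n => t i + i := by
    ext a
    have := Finset.ext_iff.1 h a
    simp only [Finset.mem_image, Finset.mem_range] at this
    simpa [Fin.exists_iff] using this
  have := congrFun ((hs'.range_inj ht').1 hr) ⟨j, hj⟩
  simpa using this

theorem exists_representatives {α : Type*} (s : Set α) (g : α → Finset ℕ) (n : ℕ)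
    (h : ∀ a ∈ s, g a ⊆ Finset.range n) :
    ∃ t ⊆ s, t.Finite ∧ t.ncard ≤ 2 ^ n ∧ ∀ a ∈ s, ∃ b ∈ t, g b = g a := by
  obtain ⟨t, hts, hbij⟩ := (Set.surjOn_image g s).exists_bijOn_subset
  have hsub : g '' s ⊆ ((Finset.range n).powerset : Set (Finset ℕ)) := by
    rintro _ ⟨a, ha, rfl⟩
    exact Finset.mem_coe.2 (Finset.mem_powerset.2 (h a ha))
  have hfin : (g '' s).Finite := (Finset.finite_toSet _).subset hsub
  refine ⟨t, hts, ?_, ?_, fun a ha => hbij.surjOn ⟨a, ha, rfl⟩⟩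
  · exact Set.Finite.of_finite_image (hbij.image_eq ▸ hfin) hbij.injOn
  · rw [← hbij.injOn.ncard_image, hbij.image_eq]
    refine (Set.ncard_le_ncard hsub (Finset.finite_toSet _)).trans ?_
    rw [Set.ncard_coe_finset, Finset.card_powerset, Finset.card_range]

/-- The exponent of `t / M` rounded down to a power of `b`. -/
noncomputable def logLevel (b M t : ℝ) : ℕ := ⌊Real.log (t / M) / Real.log b⌋₊

theorem logLevel_mono {b M t u : ℝ} (hb : 1 < b) (hM : 0 < M) (ht : 0 < t) (htu : t ≤ u) :
    logLevel b M t ≤ logLevel b M u := by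
  have := Real.log_pos hb
  unfold logLevel
  gcongr

theorem le_mul_of_logLevel_eq {b M t u : ℝ} (hb : 1 < b) (hM : 0 < M) (hMt : M ≤ t)
    (hMu : M ≤ u) (h : logLevel b M t = logLevel b M u) : t ≤ b * u := by
  have hl := Real.log_pos hb
  have hu0 : 0 ≤ Real.log (u / M) := Real.log_nonneg ((one_le_div hM).2 hMu)
  have h1 := Nat.lt_floor_add_one (Real.log (t / M) / Real.log b)
  have h2 := Nat.floor_le (div_nonneg hu0 hl.le)
  unfold logLevel at h
  rw [h] at h1
  have h3 : Real.log (t / M) / Real.log b < (Real.log (u / M) + Real.log b) / Real.log b := by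
    rw [add_div, div_self hl.ne']
    linarith
  have h4 := (div_lt_div_iff_of_pos_right hl).1 h3
  have hupos : 0 < u := hM.trans_le hMu
  have htpos : 0 < t := hM.trans_le hMt
  rw [Real.log_div htpos.ne' hM.ne', Real.log_div hupos.ne' hM.ne'] at h4
  refine (Real.log_le_log_iff htpos (by positivity)).1 ?_
  rw [Real.log_mul (by positivity) hupos.ne']
  linarith

theorem two_pow_add_one_le_rpow {d : ℕ} (hd : 2 ≤ d) {ε : ℝ} (hε : 0 < ε) (hε1 : ε ≤ 1) :
    (2 : ℝ) ^ (⌊3 * (Real.log d / Real.log (1 + ε / 3))⌋₊ + 1) + 1 ≤ (d : ℝ) ^ (14 / ε) := by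
  have hd' : (2 : ℝ) ≤ d := by exact_mod_cast hd
  have hlog2 : 0 < Real.log 2 := Real.log_pos one_lt_two
  have hlog2d : Real.log 2 ≤ Real.log d := Real.log_le_log two_pos hd'
  have hlogd : 0 < Real.log d := hlog2.trans_le hlog2d
  have hlog21 : Real.log 2 ≤ 1 := by linarith [Real.log_two_lt_d9]
  have hl : ε / 4 ≤ Real.log (1 + ε / 3) := by
    have h := Real.one_sub_inv_le_log_of_pos (x := 1 + ε / 3) (by positivity)
    refine le_trans ?_ h
    have : 1 - (1 + ε / 3)⁻¹ = ε / (3 + ε) := by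
      field_simp
      ring
    rw [this]
    exact div_le_div_of_nonneg_left hε.le (by linarith) (by linarith)
  have hΛ : Real.log d / Real.log (1 + ε / 3) ≤ 4 * Real.log d / ε := by
    calc Real.log d / Real.log (1 + ε / 3) ≤ Real.log d / (ε / 4) :=
        div_le_div_of_nonneg_left hlogd.le (by positivity) hl
      _ = _ := by field_simp
  set n := ⌊3 * (Real.log d / Real.log (1 + ε / 3))⌋₊ with hn
  have hl0 : 0 < Real.log (1 + ε / 3) := lt_of_lt_of_le (by positivity) hl
  have hnle : (n : ℝ) ≤ 12 * Real.log d / ε := by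
    have h := Nat.floor_le (a := 3 * (Real.log d / Real.log (1 + ε / 3))) (by positivity)
    rw [← hn] at h
    refine h.trans ?_
    calc 3 * (Real.log d / Real.log (1 + ε / 3)) ≤ 3 * (4 * Real.log d / ε) := by linarith
      _ = _ := by ring
  calc (2 : ℝ) ^ (n + 1) + 1 ≤ 2 ^ (n + 1) + 2 ^ (n + 1) := by
        gcongr
        exact one_le_pow₀ one_le_two
    _ = 2 ^ (n + 2) := by ring
    _ ≤ (d : ℝ) ^ (14 / ε) := by
      refine (Real.log_le_log_iff (by positivity) (by positivity)).1 ?_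
      rw [Real.log_pow, Real.log_rpow (by linarith)]
      push_cast
      have h1 : (n : ℝ) * Real.log 2 ≤ 12 * Real.log d / ε := by
        refine (mul_le_of_le_one_right (Nat.cast_nonneg n) hlog21).trans hnle
      have h2 : Real.log d ≤ Real.log d / ε := le_div_self hlogd.le hε hε1
      calc ((n : ℝ) + 2) * Real.log 2 ≤ 12 * Real.log d / ε + 2 * (Real.log d / ε) := by linarith
        _ = _ := by ring

/-- Lemma: `poly(d^{1/ε})`-size `(1+ε)`-approximate portfolios for symmetric
monotonic norms over any compact `D ⊆ ℝ_{≥0}^d`. -/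
theorem stmt13 :
    ∃ C : ℝ, 0 < C ∧
      ∀ d : ℕ, 2 ≤ d → ∀ ε : ℝ, 0 < ε → ε ≤ 1 →
      ∀ D : Set (Fin d → ℝ), D.Nonempty → IsCompact D → (∀ x ∈ D, ∀ i, 0 ≤ x i) →
        ∃ X : Set (Fin d → ℝ), X ⊆ D ∧ X.Finite ∧ X.Nonempty ∧
          (X.ncard : ℝ) ≤ (d : ℝ) ^ (C / ε) ∧
          ∀ f : (Fin d → ℝ) → ℝ, IsSymMonotoneNorm f →
            ∀ y ∈ D, ∃ x ∈ X, f x ≤ (1 + ε) * f y := by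
  refine ⟨14, by norm_num, fun d hd ε hε hε1 D hDne hDc hDnn => ?_⟩
  have hd' : (2 : ℝ) ≤ d := by exact_mod_cast hd
  obtain ⟨x₀, hx₀, hmin⟩ := hDc.exists_isMinOn hDne continuous_norm.continuousOn
  have hmin' : ∀ y ∈ D, ‖x₀‖ ≤ ‖y‖ := fun y hy => hmin hy
  set M := ‖x₀‖ with hMdef
  set b := 1 + ε / 3 with hb
  have hb1 : 1 < b := by linarith [div_pos hε three_pos]
  have hlb : 0 < Real.log b := Real.log_pos hb1
  set J := ⌊Real.log d / Real.log b⌋₊ with hJ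
  set D' := {y | y ∈ D ∧ ‖y‖ < d * M} with hD'
  have hM : ∀ y ∈ D', 0 < M := by
    intro y hy
    exact pos_of_mul_pos_right ((norm_nonneg y).trans_lt hy.2) (Nat.cast_nonneg d)
  have hcard : ∀ j : ℕ, 1 ≤ ⌈b ^ j⌉₊ := fun j => Nat.ceil_pos.2 (by positivity)
  have hMle : ∀ y ∈ D', ∀ j : ℕ, M ≤ topSum y ⌈b ^ j⌉₊ := fun y hy j =>
    (hmin' y hy.1).trans (norm_le_topSum (hDnn y hy.1) (hcard j))
  set level : (Fin d → ℝ) → ℕ → ℕ := fun y j => logLevel b M (topSum y ⌈b ^ j⌉₊) with hlevel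
  have hmono : ∀ y ∈ D', Monotone (level y) := by
    intro y hy i j hij
    refine logLevel_mono hb1 (hM y hy) ((hM y hy).trans_le (hMle y hy i))
      (topSum_mono (hDnn y hy.1) (Nat.ceil_mono (pow_le_pow_right₀ hb1.le hij)))
  set sig : (Fin d → ℝ) → Finset ℕ := fun y =>
    (Finset.range (J + 1)).image fun j => level y j + j with hsig
  have hrange : ∀ y ∈ D', sig y ⊆ Finset.range (⌊3 * (Real.log d / Real.log b)⌋₊ + 1) := by
    intro y hy a ha
    obtain ⟨j, hj, rfl⟩ := Finset.mem_image.1 ha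
    have hlogd : 0 ≤ Real.log d := Real.log_nonneg (by linarith)
    have hj' : (j : ℝ) ≤ Real.log d / Real.log b :=
      (Nat.le_floor_iff (by positivity)).1 (Nat.lt_succ_iff.1 (Finset.mem_range.1 hj))
    have hMy := hM y hy
    have hTM := hMle y hy j
    have hle : topSum y ⌈b ^ j⌉₊ / M ≤ (d : ℝ) ^ 2 := by
      rw [div_le_iff₀ hMy]
      refine (topSum_le_mul_norm y _).trans ?_
      calc (d : ℝ) * ‖y‖ ≤ d * (d * M) := by
            have := hy.2.le
            gcongr
        _ = _ := by ring
    have hpos : 0 < topSum y ⌈b ^ j⌉₊ / M := div_pos (hMy.trans_le hTM) hMy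
    have hlog := Real.log_le_log hpos hle
    rw [Real.log_pow] at hlog
    push_cast at hlog
    have hfl : (level y j : ℝ) ≤ 2 * (Real.log d / Real.log b) := by
      refine (Nat.floor_le (div_nonneg
        (Real.log_nonneg ((one_le_div hMy).2 hTM)) hlb.le)).trans ?_
      rw [← mul_div_assoc]
      gcongr
    refine Finset.mem_range.2 (Nat.lt_succ_iff.2 (Nat.le_floor ?_))
    push_cast
    linarith
  obtain ⟨X, hXD, hXfin, hXcard, hX⟩ := exists_representatives D' sig _ hrange
  refine ⟨insert x₀ X, ?_, hXfin.insert x₀, Set.insert_nonempty _ _, ?_, ?_⟩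
  · exact Set.insert_subset hx₀ fun x hx => (hXD hx).1
  · refine le_trans ?_ (two_pow_add_one_le_rpow hd hε hε1)
    exact_mod_cast (Set.ncard_insert_le x₀ X).trans (Nat.add_le_add_right hXcard 1)
  intro f hf y hy
  have hynn := hDnn y hy
  by_cases hyD : ‖y‖ < d * M
  · obtain ⟨x, hxX, hxy⟩ := hX y ⟨hy, hyD⟩
    have hyD' : y ∈ D' := ⟨hy, hyD⟩
    have hxD' := hXD hxX
    have hxnn := hDnn x hxD'.1
    refine ⟨x, Set.mem_insert_of_mem _ hxX,
      hf.le_mul_of_topSum_le (by linarith) hxnn hynn fun m => ?_⟩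
    refine (topSum_le_of_le_at_powers (div_pos hε three_pos) hxnn hynn
      (fun j hj => ?_) m).trans ?_
    · have hjJ : j < J + 1 := by
        refine Nat.lt_succ_iff.2 (Nat.le_floor ?_)
        rw [le_div_iff₀ hlb, ← Real.log_pow]
        exact Real.log_le_log (by positivity) hj
      exact le_mul_of_logLevel_eq hb1 (hM y hyD') (hMle x hxD' j) (hMle y hyD' j)
        (eq_of_image_add_id_eq (hmono x hxD') (hmono y hyD') hxy hjJ)
    · refine mul_le_mul_of_nonneg_right ?_ (topSum_nonneg hynn m)
      nlinarith
  · refine ⟨x₀, Set.mem_insert _ _,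
      hf.le_mul_of_topSum_le (by linarith) (hDnn x₀ hx₀) hynn fun m => ?_⟩
    rcases Nat.eq_zero_or_pos m with rfl | hm
    · simp [topSum]
    calc topSum x₀ m ≤ d * M := topSum_le_mul_norm x₀ m
      _ ≤ ‖y‖ := not_lt.1 hyD
      _ ≤ topSum y m := norm_le_topSum hynn hm
      _ ≤ (1 + ε) * topSum y m :=
        le_mul_of_one_le_left (topSum_nonneg hynn m) (by linarith)
end

section
/- Let d ≥ 1 and let p_1 ≤ p_2 ≤ … ≤ p_d be positive reals, each an integer power of 2, and let n ≥ 1 be an integer; let D = {(n_1 p_1,…,n_d p_d) : n_1,…,n_d ∈ ℕ, Σ_i n_i = n}. Then for every x ∈ D there exists y ∈ D with y_1 ≥ y_2 ≥ … ≥ y_d and y ⪯ x; consequently ‖y‖_f ≤ ‖x‖_f for every symmetric monotonic norm ‖·‖_f on ℝ^d. -/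
/-- A function that is convex, does not increase under permutations of coordinates, and is
monotone on nonnegative vectors. -/
structure IsConvexSymMono {ι : Type*} (f : (ι → ℝ) → ℝ) : Prop where
  convex : ∀ (a b : ℝ) (x y : ι → ℝ), 0 ≤ a → 0 ≤ b → a + b = 1 →
    f (a • x + b • y) ≤ a * f x + b * f y
  symm : ∀ (σ : Equiv.Perm ι) (x : ι → ℝ), f (x ∘ σ) ≤ f x
  mono : ∀ x y : ι → ℝ, (∀ i, 0 ≤ x i) → (∀ i, x i ≤ y i) → f x ≤ f y

theorem IsSymMonotoneNorm.isConvexSymMono {ι : Type*} [Fintype ι] {f : (ι → ℝ) → ℝ}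
    (hf : IsSymMonotoneNorm f) : IsConvexSymMono f := by
  obtain ⟨-, hsmul, hadd, hperm, hmono⟩ := hf
  refine ⟨fun a b x y ha hb _ => ?_, fun σ x => (hperm σ x).le, hmono⟩
  calc f (a • x + b • y) ≤ f (a • x) + f (b • y) := hadd _ _
    _ = a * f x + b * f y := by rw [hsmul, hsmul, abs_of_nonneg ha, abs_of_nonneg hb]

/-- Moving load from coordinate `j` to coordinate `i` does not increase `f`, provided at least as
much is removed as is added and the new load on `i` does not exceed the old load on `j`. -/
theorem IsConvexSymMono.le_of_transfer {ι : Type*} {f : (ι → ℝ) → ℝ}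
    (hf : IsConvexSymMono f) {x y : ι → ℝ} {i j : ι} {a b : ℝ} (hy : ∀ k, 0 ≤ y k)
    (ha : 0 ≤ a) (hab : a ≤ b) (hlt : x i < x j) (hle : x i + a ≤ x j)
    (hyi : y i = x i + a) (hyj : y j = x j - b) (hyk : ∀ k, k ≠ i → k ≠ j → y k = x k) :
    f y ≤ f x := by
  classical
  have hpos : 0 < x j - x i := sub_pos.2 hlt
  set t : ℝ := a / (x j - x i) with ht
  have ht0 : 0 ≤ t := div_nonneg ha hpos.le
  have ht1 : t ≤ 1 := (div_le_one hpos).2 (by linarith)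
  have hta : t * (x j - x i) = a := div_mul_cancel₀ _ hpos.ne'
  calc f y ≤ f ((1 - t) • x + t • (x ∘ Equiv.swap i j)) := by
        refine hf.mono _ _ hy fun k => ?_
        simp only [Pi.add_apply, Pi.smul_apply, Function.comp_apply, smul_eq_mul]
        by_cases hki : k = i
        · subst hki
          rw [Equiv.swap_apply_left]
          linarith
        by_cases hkj : k = j
        · subst hkj
          rw [Equiv.swap_apply_right]
          linarith
        · rw [Equiv.swap_apply_of_ne_of_ne hki hkj, hyk k hki hkj]
          linarith
    _ ≤ (1 - t) * f x + t * f (x ∘ Equiv.swap i j) :=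
        hf.convex _ _ _ _ (by linarith) ht0 (by ring)
    _ ≤ (1 - t) * f x + t * f x := by gcongr; exact hf.symm _ _
    _ = f x := by ring

theorem Antitone.sum_le_sum_filter_lt {d k : ℕ} {a : Fin d → ℝ} (ha : Antitone a)
    (ha0 : ∀ i, 0 ≤ a i) {t : Finset (Fin d)} (ht : t.card ≤ k) :
    ∑ i ∈ t, a i ≤ ∑ i ∈ Finset.univ.filter (fun i : Fin d => (i : ℕ) < k), a i := by
  set u := Finset.univ.filter (fun i : Fin d => (i : ℕ) < k) with hu
  rcases lt_or_ge k d with hk | hk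
  · have hcard : u.card = k := by
      rw [hu, Fin.card_filter_val_lt]
      exact min_eq_right hk.le
    have hcard' : (t \ u).card ≤ (u \ t).card := by
      have h1 := Finset.card_sdiff_add_card_inter t u
      have h2 := Finset.card_sdiff_add_card_inter u t
      rw [Finset.inter_comm] at h2
      omega
    have h1 : ∑ i ∈ t \ u, a i ≤ (t \ u).card • a ⟨k, hk⟩ := by
      refine Finset.sum_le_card_nsmul _ _ _ fun i hi => ha ?_
      simpa [hu, Fin.le_def] using (Finset.mem_sdiff.1 hi).2
    have h2 : (u \ t).card • a ⟨k, hk⟩ ≤ ∑ i ∈ u \ t, a i := by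
      refine Finset.card_nsmul_le_sum _ _ _ fun i hi => ha ?_
      have := (Finset.mem_sdiff.1 hi).1
      simp only [hu, Finset.mem_filter] at this
      exact Fin.le_def.2 this.2.le
    have h3 := nsmul_le_nsmul_left (ha0 ⟨k, hk⟩) hcard'
    rw [← Finset.sum_inter_add_sum_sdiff t u, ← Finset.sum_inter_add_sum_sdiff u t,
      Finset.inter_comm u t]
    linarith
  · refine Finset.sum_le_sum_of_subset_of_nonneg (fun i _ => ?_) fun i _ _ => ha0 i
    simp only [hu, Finset.mem_filter, Finset.mem_univ, true_and]
    exact i.isLt.trans_le hk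

theorem sum_abs_le_topkNorm {d k : ℕ} (x : Fin d → ℝ) {s : Finset (Fin d)} (hs : s.card ≤ k) :
    ∑ i ∈ s, |x i| ≤ topkNorm k x := by
  set τ : Equiv.Perm (Fin d) := Fin.revPerm.trans (Tuple.sort fun i => |x i|) with hτ
  have h : ∑ i ∈ s, |x i| = ∑ i ∈ s.map τ.symm.toEmbedding, absSortDesc x i := by
    rw [Finset.sum_map]
    refine Finset.sum_congr rfl fun i _ => ?_
    change |x i| = |x (τ (τ.symm i))|
    rw [Equiv.apply_symm_apply]
  rw [h]
  exact (absSortDesc_antitone x).sum_le_sum_filter_lt (fun _ => abs_nonneg _)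
    (by rwa [Finset.card_map])

theorem exists_topkNorm_eq_sum_abs {d : ℕ} (k : ℕ) (x : Fin d → ℝ) :
    ∃ s : Finset (Fin d), s.card ≤ k ∧ topkNorm k x = ∑ i ∈ s, |x i| := by
  set τ : Equiv.Perm (Fin d) := Fin.revPerm.trans (Tuple.sort fun i => |x i|) with hτ
  refine ⟨(Finset.univ.filter (fun i : Fin d => (i : ℕ) < k)).map τ.toEmbedding, ?_, ?_⟩
  · rw [Finset.card_map, Fin.card_filter_val_lt]
    exact min_le_right _ _
  · rw [Finset.sum_map]
    rfl

theorem isConvexSymMono_topkNorm {d : ℕ} (k : ℕ) :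
    IsConvexSymMono (topkNorm k : (Fin d → ℝ) → ℝ) where
  convex a b x y ha hb _ := by
    obtain ⟨s, hs, h⟩ := exists_topkNorm_eq_sum_abs k (a • x + b • y)
    calc topkNorm k (a • x + b • y) = ∑ i ∈ s, |a * x i + b * y i| := h
      _ ≤ ∑ i ∈ s, (a * |x i| + b * |y i|) := by
          refine Finset.sum_le_sum fun i _ => (abs_add_le _ _).trans_eq ?_
          rw [abs_mul, abs_mul, abs_of_nonneg ha, abs_of_nonneg hb]
      _ = a * ∑ i ∈ s, |x i| + b * ∑ i ∈ s, |y i| := by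
          rw [Finset.sum_add_distrib, Finset.mul_sum, Finset.mul_sum]
      _ ≤ a * topkNorm k x + b * topkNorm k y := by
          gcongr <;> exact sum_abs_le_topkNorm _ hs
  symm σ x := by
    obtain ⟨s, hs, h⟩ := exists_topkNorm_eq_sum_abs k (x ∘ σ)
    have h' : ∑ i ∈ s, |(x ∘ σ) i| = ∑ i ∈ s.map σ.toEmbedding, |x i| := by
      rw [Finset.sum_map]
      rfl
    rw [h, h']
    exact sum_abs_le_topkNorm _ (by rwa [Finset.card_map])
  mono x y hx hxy := by
    obtain ⟨s, hs, h⟩ := exists_topkNorm_eq_sum_abs k x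
    rw [h]
    exact (Finset.sum_le_sum fun i _ => abs_le_abs_of_nonneg (hx i) (hxy i)).trans
      (sum_abs_le_topkNorm _ hs)

/-- If each `p i` divides every later `p j`, then any assignment of jobs can be improved, for all
`IsConvexSymMono` functions simultaneously, to one with nonincreasing loads. -/
theorem exists_antitone_loads {d : ℕ} {p : Fin d → ℝ} (hpos : ∀ i, 0 < p i) (hmono : Monotone p)
    (hdvd : ∀ i j, i ≤ j → ∃ c : ℕ, p j = c * p i) (m : Fin d → ℕ) :
    ∃ m' : Fin d → ℕ, ∑ i, m' i = ∑ i, m i ∧ Antitone (fun i => (m' i : ℝ) * p i) ∧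
      ∀ f : (Fin d → ℝ) → ℝ, IsConvexSymMono f →
        f (fun i => (m' i : ℝ) * p i) ≤ f (fun i => (m i : ℝ) * p i) := by
  induction hN : ∑ i, m i * (i : ℕ) using Nat.strong_induction_on generalizing m with
  | _ N ih =>
  by_cases hm : Antitone (fun i => (m i : ℝ) * p i)
  · exact ⟨m, rfl, hm, fun _ _ => le_rfl⟩
  simp only [Antitone, not_forall, not_le] at hm
  obtain ⟨i, j, hij, hlt⟩ := hm
  have hne : i ≠ j := by
    rintro rfl
    exact lt_irrefl _ hlt
  have hij' : (i : ℕ) < j := Fin.lt_def.1 (lt_of_le_of_ne hij hne)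
  have hmj : 1 ≤ m j := by
    rw [Nat.one_le_iff_ne_zero]
    intro h0
    rw [h0, Nat.cast_zero, zero_mul] at hlt
    exact hlt.not_ge (mul_nonneg (Nat.cast_nonneg _) (hpos i).le)
  have hstep : (m i : ℝ) * p i + p i ≤ m j * p j := by
    obtain ⟨c, hc⟩ := hdvd i j hij
    rw [hc, ← mul_assoc] at hlt ⊢
    have h1 : (m i : ℝ) < m j * c := lt_of_mul_lt_mul_right hlt (hpos i).le
    have h2 : (m i : ℝ) + 1 ≤ m j * c := by exact_mod_cast h1
    nlinarith [hpos i]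
  obtain ⟨r, hr⟩ : ∃ r : Fin d → ℕ, m = r + Pi.single j 1 := by
    refine ⟨m - Pi.single j 1, (tsub_add_cancel_of_le fun k => ?_).symm⟩
    by_cases hk : k = j
    · subst hk
      simpa using hmj
    · simp [hk]
  set m₁ : Fin d → ℕ := r + Pi.single i 1 with hm₁
  have hsum : ∑ k, m₁ k = ∑ k, m k := by
    simp [hr, hm₁, Finset.sum_add_distrib]
  have hpot : ∑ k, m₁ k * (k : ℕ) < N := by
    rw [← hN]
    simpa [hr, hm₁, add_mul, Finset.sum_add_distrib, Pi.single_apply] using hij'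
  obtain ⟨m', hm's, hm'a, hm'f⟩ := ih _ hpot m₁ rfl
  refine ⟨m', hm's.trans hsum, hm'a, fun f hf => (hm'f f hf).trans ?_⟩
  refine hf.le_of_transfer (i := i) (j := j) (a := p i) (b := p j)
    (fun k => mul_nonneg (Nat.cast_nonneg _) (hpos k).le) (hpos i).le (hmono hij) hlt hstep
    ?_ ?_ fun k hki hkj => ?_
  · simp [hr, hm₁, hne]
    ring
  · simp [hr, hm₁, hne.symm]
    ring
  · simp [hr, hm₁, hki, hkj]

/-- Lemma: for doubling MLIJ instances, every feasible load vector is majorized-dominated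
by a feasible load vector with nonincreasing coordinates. -/
theorem stmt14 {d : ℕ} (hd : 1 ≤ d) (p : Fin d → ℝ) (hpos : ∀ i, 0 < p i)
    (hmono : Monotone p) (hpow : ∀ i, ∃ z : ℤ, p i = 2 ^ z)
    (n : ℕ) (hn : 1 ≤ n) :
    ∀ x ∈ MLIJ p n, ∃ y ∈ MLIJ p n,
      Antitone y ∧
      (∀ k : ℕ, 1 ≤ k → k ≤ d → topkNorm k y ≤ topkNorm k x) ∧
      ∀ f : (Fin d → ℝ) → ℝ, IsSymMonotoneNorm f → f y ≤ f x := by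
  rintro x ⟨m, hm, hx⟩
  obtain rfl : x = fun i => (m i : ℝ) * p i := funext hx
  have hdvd : ∀ i j, i ≤ j → ∃ c : ℕ, p j = c * p i := by
    intro i j hij
    obtain ⟨a, ha⟩ := hpow i
    obtain ⟨b, hb⟩ := hpow j
    have hab : a ≤ b := by
      have h := hmono hij
      rwa [ha, hb, zpow_le_zpow_iff_right₀ one_lt_two] at h
    obtain ⟨e, rfl⟩ := Int.le.dest hab
    refine ⟨2 ^ e, ?_⟩
    rw [hb, ha, zpow_add₀ two_ne_zero, zpow_natCast]
    push_cast
    ring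
  obtain ⟨m₁, hs, hanti, hf⟩ := exists_antitone_loads hpos hmono hdvd m
  exact ⟨_, ⟨m₁, hs.trans hm, fun _ => rfl⟩, hanti,
    fun k _ _ => hf _ (isConvexSymMono_topkNorm k), fun f h => hf f h.isConvexSymMono⟩
end

section
/- Let d ≥ 1, let p_1,…,p_d > 0, let n > 0, and let P = { x ∈ ℝ^d : Σ_{i=1}^d x_i/p_i = n, x_1 ≥ x_2 ≥ … ≥ x_d ≥ 0 }. For l ∈ {1,…,d} define x(l) ∈ ℝ^d by x(l)_i = n / (Σ_{j=1}^l 1/p_j) for i ≤ l and x(l)_i = 0 for i > l. Then for every weight vector w ∈ ℝ^d there exists l ∈ {1,…,d} such that wᵀx(l) = min_{x∈P} wᵀx. -/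
/-- If all prefix sums of `g` are nonnegative and `x` is nonincreasing and nonnegative, then
`∑ i, g i * x i` is nonnegative. -/
theorem sum_mul_nonneg_of_prefix_sums_nonneg {d : ℕ} (g x : Fin d → ℝ)
    (hg : ∀ l, 0 ≤ ∑ i ∈ Finset.Iic l, g i) (hx : Antitone x) (hx0 : ∀ i, 0 ≤ x i) :
    0 ≤ ∑ i, g i * x i := by
  induction d with
  | zero => simp
  | succ d ih =>
    have hinit : 0 ≤ ∑ i : Fin d, g i.castSucc * (x i.castSucc - x (Fin.last d)) := by
      refine ih (fun i => g i.castSucc) (fun i => x i.castSucc - x (Fin.last d)) ?_ ?_ ?_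
      · intro l
        simpa only [Fin.sum_Iic_castSucc] using hg l.castSucc
      · intro i j hij
        exact sub_le_sub_right (hx (Fin.castSucc_le_castSucc_iff.2 hij)) _
      · intro i
        exact sub_nonneg.2 (hx (Fin.le_last _))
    have htotal : 0 ≤ ∑ i, g i := by
      have hIic : Finset.Iic (Fin.last d) = Finset.univ := by
        ext i
        simp [Fin.le_last]
      simpa [hIic] using hg (Fin.last d)
    have hsplit : ∑ i, g i * x i =
        ∑ i : Fin d, g i.castSucc * (x i.castSucc - x (Fin.last d)) +
          (∑ i, g i) * x (Fin.last d) := by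
      simp only [Fin.sum_univ_castSucc, mul_sub, Finset.sum_sub_distrib, add_mul,
        Finset.sum_mul]
      ring
    rw [hsplit]
    exact add_nonneg hinit (mul_nonneg htotal (hx0 _))

/-- The pairing of a vector with `vertexX p n l` only involves its prefix sum up to `l`. -/
theorem sum_mul_vertexX {d : ℕ} (p w : Fin d → ℝ) (n : ℝ) (l : Fin d) :
    ∑ i, w i * vertexX p n l i =
      (∑ i ∈ Finset.Iic l, w i) * (n / ∑ j ∈ Finset.Iic l, 1 / p j) := by
  simp only [vertexX, mul_ite, mul_zero, ← Finset.sum_filter, Finset.filter_ge_eq_Iic,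
    Finset.sum_mul]

/-- For positive `p`, the sums of `1 / p` over initial segments are positive. -/
theorem sum_Iic_one_div_pos {d : ℕ} {p : Fin d → ℝ} (hp : ∀ i, 0 < p i) (l : Fin d) :
    0 < ∑ j ∈ Finset.Iic l, 1 / p j :=
  Finset.sum_pos (fun j _ => one_div_pos.2 (hp j)) ⟨l, Finset.mem_Iic.2 le_rfl⟩

/-- `vertexX p n l` satisfies the normalization constraint. -/
theorem sum_vertexX_div {d : ℕ} {p : Fin d → ℝ} (hp : ∀ i, 0 < p i) (n : ℝ) (l : Fin d) :
    ∑ i, vertexX p n l i / p i = n := by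
  have h := sum_mul_vertexX p (fun i => 1 / p i) n l
  rw [mul_div_cancel₀ n (sum_Iic_one_div_pos hp l).ne'] at h
  exact (Finset.sum_congr rfl fun i _ => by ring).trans h

theorem vertexX_nonneg {d : ℕ} {p : Fin d → ℝ} (hp : ∀ i, 0 < p i) {n : ℝ} (hn : 0 ≤ n)
    (l i : Fin d) : 0 ≤ vertexX p n l i := by
  unfold vertexX
  split_ifs
  · exact div_nonneg hn (Finset.sum_nonneg fun j _ => (one_div_pos.2 (hp j)).le)
  · exact le_rfl

theorem antitone_vertexX {d : ℕ} {p : Fin d → ℝ} (hp : ∀ i, 0 < p i) {n : ℝ} (hn : 0 ≤ n)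
    (l : Fin d) : Antitone (vertexX p n l) := by
  intro i j hij
  by_cases hj : j ≤ l
  · simp [vertexX, hj, hij.trans hj]
  · have hzero : vertexX p n l j = 0 := by simp [vertexX, hj]
    rw [hzero]
    exact vertexX_nonneg hp hn l i

/-- Lemma: any weight vector is minimized over the order polytope `P` at one of the
vertices `x(l)`. -/
theorem stmt15 {d : ℕ} (hd : 1 ≤ d) (p : Fin d → ℝ) (hp : ∀ i, 0 < p i)
    (n : ℝ) (hn : 0 < n)
    (P : Set (Fin d → ℝ))
    (hP : P = {x | (∑ i, x i / p i) = n ∧ Antitone x ∧ ∀ i, 0 ≤ x i}) :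
    ∀ w : Fin d → ℝ, IsWeightVector w →
      ∃ l : Fin d, vertexX p n l ∈ P ∧
        ∀ x ∈ P, (∑ i, w i * vertexX p n l i) ≤ ∑ i, w i * x i := by
  intro w _
  subst hP
  have : Nonempty (Fin d) := ⟨⟨0, hd⟩⟩
  obtain ⟨l, hl⟩ := Finite.exists_min fun l : Fin d =>
    (∑ i ∈ Finset.Iic l, w i) / ∑ i ∈ Finset.Iic l, 1 / p i
  refine ⟨l, ⟨sum_vertexX_div hp n l, antitone_vertexX hp hn.le l,
    vertexX_nonneg hp hn.le l⟩, ?_⟩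
  rintro x ⟨hsum, hanti, hnonneg⟩
  rw [sum_mul_vertexX]
  set c := (∑ i ∈ Finset.Iic l, w i) / ∑ i ∈ Finset.Iic l, 1 / p i with hc
  have hprefix : ∀ k, 0 ≤ ∑ i ∈ Finset.Iic k, (w i - c * (1 / p i)) := by
    intro k
    rw [Finset.sum_sub_distrib, ← Finset.mul_sum, sub_nonneg]
    exact (le_div_iff₀ (sum_Iic_one_div_pos hp k)).1 (hl k)
  have hmain := sum_mul_nonneg_of_prefix_sums_nonneg _ x hprefix hanti hnonneg
  have hexpand : ∑ i, (w i - c * (1 / p i)) * x i = ∑ i, w i * x i - c * n := by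
    rw [← hsum, Finset.mul_sum, ← Finset.sum_sub_distrib]
    exact Finset.sum_congr rfl fun i _ => by ring
  rw [hexpand, sub_nonneg] at hmain
  calc _ = c * n := by rw [hc]; ring
    _ ≤ _ := hmain
end

section
/- Let d ≥ 1, let p_1 ≤ p_2 ≤ … ≤ p_d be positive reals, and let n ≥ 1 be an integer. Fix l ∈ {1,…,d} and define x(l) ∈ ℝ^d by x(l)_i = n / (Σ_{j=1}^l 1/p_j) for i ≤ l and x(l)_i = 0 for i > l. If n / (Σ_{j=1}^l 1/p_j) ≥ p_l, then there exist n_1,…,n_d ∈ ℕ with Σ_{i=1}^d n_i = n, n_i = 0 for all i > l, and (1/2)·x(l)_i ≤ n_i·p_i ≤ 2·x(l)_i for all i ∈ {1,…,d}. -/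
/-- Between two natural-valued functions on a finite type there is one with any prescribed
intermediate sum. -/
theorem exists_between_sum_eq {ι : Type*} [Fintype ι] {f g : ι → ℕ} (hfg : f ≤ g) {n : ℕ}
    (hf : ∑ i, f i ≤ n) (hg : n ≤ ∑ i, g i) :
    ∃ m : ι → ℕ, f ≤ m ∧ m ≤ g ∧ ∑ i, m i = n := by
  classical
  induction n, hf using Nat.le_induction with
  | base => exact ⟨f, le_rfl, hfg, rfl⟩
  | succ n _ ih =>
    obtain ⟨m, hfm, hmg, hm⟩ := ih (by omega)
    obtain ⟨i, -, hi⟩ := Finset.exists_lt_of_sum_lt (show ∑ i, m i < ∑ i, g i by omega)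
    refine ⟨m + Pi.single i 1, hfm.trans (by simp), fun j => ?_, ?_⟩
    · by_cases hj : j = i
      · subst hj
        simpa using hi
      · simpa [hj] using hmg j
    · simp [Finset.sum_add_distrib, hm]

/-- A nonnegative real vector with natural sum can be rounded coordinatewise, preserving
the sum. -/
theorem exists_rounding_sum_eq {ι : Type*} [Fintype ι] {a : ι → ℝ} (ha : ∀ i, 0 ≤ a i) {n : ℕ}
    (hsum : ∑ i, a i = n) :
    ∃ m : ι → ℕ, (∀ i, ⌊a i⌋₊ ≤ m i) ∧ (∀ i, m i ≤ ⌈a i⌉₊) ∧ ∑ i, m i = n := by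
  refine exists_between_sum_eq (fun i => Nat.floor_le_ceil (a i)) ?_ ?_
  · rw [← Nat.cast_le (α := ℝ), ← hsum, Nat.cast_sum]
    exact Finset.sum_le_sum fun i _ => Nat.floor_le (ha i)
  · rw [← Nat.cast_le (α := ℝ), ← hsum, Nat.cast_sum]
    exact Finset.sum_le_sum fun i _ => Nat.le_ceil (a i)

/-- Lemma: good vertices can be rounded to integral load vectors within factor 2. -/
theorem stmt16 {d : ℕ} (hd : 1 ≤ d) (p : Fin d → ℝ) (hp : ∀ i, 0 < p i)
    (hmono : Monotone p) (n : ℕ) (hn : 1 ≤ n) (l : Fin d)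
    (hgood : p l ≤ (n : ℝ) / (∑ j ∈ Finset.univ.filter (fun j : Fin d => j ≤ l), 1 / p j)) :
    ∃ m : Fin d → ℕ, (∑ i, m i) = n ∧ (∀ i, l < i → m i = 0) ∧
      ∀ i, (1 / 2 : ℝ) * vertexX p (n : ℝ) l i ≤ (m i : ℝ) * p i ∧
        (m i : ℝ) * p i ≤ 2 * vertexX p (n : ℝ) l i := by
  have hsum := sum_vertexX_div hp n l
  have ha : ∀ i, i ≤ l → 1 ≤ vertexX p n l i / p i := fun i hi => by
    rw [one_le_div (hp i), vertexX, if_pos hi]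
    exact (hmono hi).trans hgood
  have hz : ∀ i, l < i → vertexX p n l i = 0 := fun i hi => if_neg hi.not_ge
  obtain ⟨m, hfm, hmg, hm⟩ := exists_rounding_sum_eq (fun i => by
    rcases le_or_gt i l with hi | hi
    · exact zero_le_one.trans (ha i hi)
    · simp [hz i hi]) hsum
  have hm0 : ∀ i, l < i → m i = 0 := fun i hi => by simpa [hz i hi] using hmg i
  refine ⟨m, hm, hm0, fun i => ?_⟩
  rcases le_or_gt i l with hi | hi
  · have h1 := ha i hi
    have hlow : vertexX p n l i / p i < m i + 1 :=
      (Nat.lt_floor_add_one _).trans_le (by exact_mod_cast Nat.succ_le_succ (hfm i))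
    have hone : (1 : ℝ) ≤ m i := by
      exact_mod_cast (Nat.one_le_floor_iff _).2 h1 |>.trans (hfm i)
    have hup : (m i : ℝ) < vertexX p n l i / p i + 1 :=
      (Nat.cast_le.2 (hmg i)).trans_lt (Nat.ceil_lt_add_one (by linarith))
    have hx : vertexX p n l i = vertexX p n l i / p i * p i :=
      (div_mul_cancel₀ _ (hp i).ne').symm
    constructor
    · rw [hx, ← mul_assoc]
      exact mul_le_mul_of_nonneg_right (by linarith) (hp i).le
    · rw [hx, ← mul_assoc]
      exact mul_le_mul_of_nonneg_right (by linarith) (hp i).le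
  · simp [hz i hi, hm0 i hi]
end

section
/- Let r ≥ 1, m ≥ 2, and v_1,…,v_m ∈ ℝ^r. Then the number of permutations σ of {1,…,m} for which there exists λ in the standard simplex Δ_r = { λ ∈ ℝ_{≥0}^r : Σ_{i=1}^r λ_i = 1 } with ⟨λ, v_{σ(1)}⟩ > ⟨λ, v_{σ(2)}⟩ > … > ⟨λ, v_{σ(m)}⟩ is at most (m(m−1)/2)^{r−1} + 1. -/
open Finset in
/-- Sign patterns of linear functionals normalised by `∑ i, l i = 1` shatter fewer than `r` vectors
of `ℝ^r`. -/
theorem card_lt_of_shatters_signPatterns {P : Type*} [DecidableEq P] {r : ℕ}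
    (w : P → Fin r → ℝ) (𝒜 : Finset (Finset P))
    (h𝒜 : ∀ A ∈ 𝒜, ∃ l : Fin r → ℝ, (∑ i, l i) = 1 ∧
      ∀ p, (p ∈ A → 0 < ∑ i, l i * w p i) ∧ (p ∉ A → ∑ i, l i * w p i < 0))
    {s : Finset P} (hs : 𝒜.Shatters s) : #s < r := by
  by_contra! hcard
  let u : Option s → Fin r → ℝ := fun o => o.elim 1 (fun p => w p)
  have hdep : ¬ LinearIndependent ℝ u := by
    intro h
    have := h.fintype_card_le_finrank
    simp at this
    omega
  obtain ⟨g, hg, hne⟩ : ∃ g : Option s → ℝ, ∑ o, g o • u o = 0 ∧ (∃ o, g o ≠ 0) ∧ 0 ≤ g none := by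
    obtain ⟨g, hg, o, ho⟩ := Fintype.not_linearIndependent_iff.1 hdep
    rcases le_total 0 (g none) with h | h
    · exact ⟨g, hg, ⟨o, ho⟩, h⟩
    · exact ⟨-g, by simp only [Pi.neg_apply, neg_smul, Finset.sum_neg_distrib, hg, neg_zero], ⟨o, by simpa using ho⟩, by simpa using h⟩
  obtain ⟨⟨o, ho⟩, hnone⟩ := hne
  obtain ⟨A, hA, hsA⟩ := hs (t := (s.attach.filter (fun p => 0 < g (some p))).map
    (Function.Embedding.subtype _)) (by
      intro p hp
      simp only [mem_map, mem_filter, Function.Embedding.subtype_apply] at hp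
      obtain ⟨q, -, rfl⟩ := hp
      exact q.2)
  have hmem : ∀ p : s, (p : P) ∈ A ↔ 0 < g (some p) := by
    intro p
    have := congrArg ((p : P) ∈ ·) hsA
    simpa [mem_inter, p.2] using this
  obtain ⟨l, hl, hsign⟩ := h𝒜 A hA
  have hsum : ∑ o, g o * ∑ i, l i * u o i = 0 := by
    calc ∑ o, g o * ∑ i, l i * u o i = ∑ i, l i * (∑ o, g o • u o) i := by
          simp only [mul_sum, Finset.sum_apply, Pi.smul_apply, smul_eq_mul]
          rw [sum_comm]
          exact sum_congr rfl fun _ _ => sum_congr rfl fun _ _ => by ring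
      _ = 0 := by simp only [hg, Pi.zero_apply, mul_zero, sum_const_zero]
  have hpos : ∀ o, g o ≠ 0 → 0 < g o * ∑ i, l i * u o i := by
    rintro (_ | p) h
    · simpa [u, hl] using lt_of_le_of_ne hnone h.symm
    · rcases lt_or_gt_of_ne h with h' | h'
      · exact mul_pos_of_neg_of_neg h' ((hsign p).2 fun hp => h'.not_gt ((hmem p).1 hp))
      · exact mul_pos h' ((hsign p).1 ((hmem p).2 h'))
  refine (sum_pos' (fun o _ => ?_) ⟨o, mem_univ o, hpos o ho⟩).ne' hsum
  by_cases h : g o = 0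
  · simp [h]
  · exact (hpos o h).le

theorem sum_range_choose_le_pow_add_one {N : ℕ} (hN : 1 ≤ N) (d : ℕ) :
    ∑ k ∈ Finset.range (d + 1), N.choose k ≤ N ^ d + 1 := by
  induction d with
  | zero => simp
  | succ d ih =>
    rw [Finset.sum_range_succ]
    rcases d with _ | d
    · simp [add_comm]
    have hch : N.choose (d + 2) ≤ N ^ (d + 1) * (N - 1) := by
      obtain ⟨n, rfl⟩ : ∃ n, N = n + 1 := ⟨N - 1, by omega⟩
      calc (n + 1).choose (d + 2) ≤ (n + 1).descFactorial (d + 2) := by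
            rw [Nat.descFactorial_eq_factorial_mul_choose]
            exact Nat.le_mul_of_pos_left _ (Nat.factorial_pos _)
        _ = (n + 1) * (n.descFactorial d.succ) := by
            rw [Nat.succ_descFactorial_succ]
        _ ≤ (n + 1) * n ^ (d + 1) := by gcongr; exact Nat.descFactorial_le_pow _ _
        _ ≤ (n + 1) ^ (d + 1) * n := by
            rw [pow_succ n, pow_succ' (n + 1), mul_assoc]
            gcongr
            omega
    have hpow : N ^ (d + 1) + N ^ (d + 1) * (N - 1) = N ^ (d + 2) := by
      obtain ⟨n, rfl⟩ : ∃ n, N = n + 1 := ⟨N - 1, by omega⟩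
      simp only [Nat.add_sub_cancel]
      ring
    change _ + N.choose (d + 2) ≤ N ^ (d + 2) + 1
    omega

/-- The pairs `j < b` in `Fin m` that `σ` lists in decreasing order. -/
def inversionFinset {m : ℕ} (σ : Equiv.Perm (Fin m)) : Finset (Σ b : Fin m, Fin b) :=
  Finset.univ.filter fun p => σ.symm p.1 < σ.symm (p.2.castLT (p.2.2.trans p.1.2))

theorem inversionFinset_injective (m : ℕ) :
    Function.Injective (inversionFinset : Equiv.Perm (Fin m) → _) := by
  intro σ τ h
  have key : ∀ a b : Fin m, a < b → (σ.symm b < σ.symm a ↔ τ.symm b < τ.symm a) := by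
    intro a b hab
    have := congrArg ((⟨b, ⟨a, hab⟩⟩ : Σ b : Fin m, Fin b) ∈ ·) h
    simpa [inversionFinset] using this
  have key' : ∀ a b : Fin m, σ.symm a < σ.symm b → τ.symm a < τ.symm b := by
    intro a b hab
    rcases lt_trichotomy a b with h' | rfl | h'
    · refine lt_of_le_of_ne (not_lt.1 fun hlt => hab.not_gt ((key a b h').2 hlt)) ?_
      exact fun he => h'.ne (τ.symm.injective he)
    · exact absurd hab (lt_irrefl _)
    · exact (key b a h').1 hab
  have hmono : StrictMono (σ.trans τ.symm) := fun x y hxy => key' _ _ (by simpa using hxy)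
  have hid : (hmono.orderIsoOfSurjective _ (σ.trans τ.symm).surjective) = OrderIso.refl (Fin m) :=
    Subsingleton.elim _ _
  ext x
  have hx : τ.symm (σ x) = x := congrArg (fun e : Fin m ≃o Fin m => e x) hid
  rw [← hx, τ.apply_symm_apply, hx]

theorem card_sigma_fin (m : ℕ) : Fintype.card (Σ b : Fin m, Fin b) = m * (m - 1) / 2 := by
  rw [Fintype.card_sigma, ← Finset.sum_range_id, Finset.sum_range]
  simp

/-- Lemma: counting linear orders realizable over the simplex. -/
theorem stmt18 (r m : ℕ) (hr : 1 ≤ r) (hm : 2 ≤ m) (v : Fin m → Fin r → ℝ) :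
    Set.ncard {σ : Equiv.Perm (Fin m) |
        ∃ l : Fin r → ℝ, (∀ i, 0 ≤ l i) ∧ (∑ i, l i) = 1 ∧
          ∀ a b : Fin m, a < b → (∑ i, l i * v (σ b) i) < (∑ i, l i * v (σ a) i)} ≤
      (m * (m - 1) / 2) ^ (r - 1) + 1 := by
  classical
  set S := {σ : Equiv.Perm (Fin m) |
        ∃ l : Fin r → ℝ, (∀ i, 0 ≤ l i) ∧ (∑ i, l i) = 1 ∧
          ∀ a b : Fin m, a < b → (∑ i, l i * v (σ b) i) < (∑ i, l i * v (σ a) i)}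
  let 𝒜 : Finset (Finset (Σ b : Fin m, Fin b)) := S.toFinset.image inversionFinset
  have hcard : S.ncard = 𝒜.card := by
    rw [Finset.card_image_of_injective _ (inversionFinset_injective m), Set.ncard_eq_toFinset_card']
  have hvc : 𝒜.vcDim ≤ r - 1 := by
    refine Finset.sup_le fun s hs => Nat.le_sub_one_of_lt ?_
    refine card_lt_of_shatters_signPatterns
      (fun p i => v p.1 i - v (p.2.castLT (p.2.2.trans p.1.2)) i) 𝒜 ?_ (Finset.mem_shatterer.1 hs)
    intro A hA
    obtain ⟨σ, hσ, rfl⟩ := Finset.mem_image.1 hA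
    obtain ⟨l, -, hl, hlt⟩ := Set.mem_toFinset.1 hσ
    have hlt' : ∀ a b, σ.symm a < σ.symm b → ∑ i, l i * v b i < ∑ i, l i * v a i :=
      fun a b hab => by simpa using hlt _ _ hab
    refine ⟨l, hl, fun p => ?_⟩
    simp only [inversionFinset, Finset.mem_filter, Finset.mem_univ, true_and, mul_sub,
      Finset.sum_sub_distrib, sub_pos, sub_neg, not_lt]
    refine ⟨hlt' _ _, fun h => hlt' _ _ (lt_of_le_of_ne h fun he => ?_)⟩
    exact p.2.2.ne (congrArg Fin.val (σ.symm.injective he))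
  have hN : 1 ≤ m * (m - 1) / 2 := by
    rw [Nat.le_div_iff_mul_le two_pos]
    exact (Nat.mul_le_mul hm (by omega : 1 ≤ m - 1)).trans' (by norm_num)
  calc S.ncard ≤ 𝒜.shatterer.card := hcard.trans_le 𝒜.card_le_card_shatterer
    _ ≤ ∑ k ∈ Finset.Iic 𝒜.vcDim, (Fintype.card (Σ b : Fin m, Fin b)).choose k :=
        Finset.card_shatterer_le_sum_vcDim
    _ ≤ ∑ k ∈ Finset.range (r - 1 + 1), (m * (m - 1) / 2).choose k := by
        rw [card_sigma_fin]
        refine Finset.sum_le_sum_of_subset fun k hk => ?_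
        rw [Finset.mem_Iic] at hk
        rw [Finset.mem_range]
        omega
    _ ≤ (m * (m - 1) / 2) ^ (r - 1) + 1 := sum_range_choose_le_pow_add_one hN _
end
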